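/- There exists an absolute constant C > 0 such that the following holds. For every finite set V with |V| = n ≥ 2, every family of vectors (ū)_{u∈V} of norm at most 1 satisfying the ℓ2²-triangle inequalities, every real m ≥ 4 and every β ∈ (0,1), there exists a random subset S ⊆ V (a probability distribution over subsets of V) that is a hypergraph m-orthogonal separator with separation threshold β, probability scale α ≥ 1/n, and distortion D ≤ C·β^{-1}·m·(log₂ m)·(log₂ log₂ m)·√(log₂ n). -/

import Mathlib

open scoped Classical BigOperators RealInnerProductSpace

noncomputable section

/-- A hyperedge `e` is cut by a set `S` if `e ∩ S ≠ ∅` and `e \ S ≠ ∅`. -/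
def Cuts {V : Type*} [DecidableEq V] (S e : Finset V) : Prop :=
  (e ∩ S).Nonempty ∧ (e \ S).Nonempty

/-- Number of hyperedges (indexed by `ι`) cut by `S`. -/
def cutCount {V ι : Type*} [DecidableEq V] [Fintype ι]
    (ed : ι → Finset V) (S : Finset V) : ℕ :=
  (Finset.univ.filter (fun i => Cuts S (ed i))).card

/-- `max_{u,v ∈ e} ‖x u - x v‖²`. -/
def maxDistSq {V H : Type*} [NormedAddCommGroup H] (x : V → H) (e : Finset V) : ℝ :=
  sSup {d : ℝ | ∃ u ∈ e, ∃ v ∈ e, d = ‖x u - x v‖ ^ 2}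

/-- `max_{u,v ∈ e} ‖x u - x v‖`. -/
def maxDist {V H : Type*} [NormedAddCommGroup H] (x : V → H) (e : Finset V) : ℝ :=
  sSup {d : ℝ | ∃ u ∈ e, ∃ v ∈ e, d = ‖x u - x v‖}

/-- `min_{w ∈ e} ‖x w‖`. -/
def minNorm {V H : Type*} [NormedAddCommGroup H] (x : V → H) (e : Finset V) : ℝ :=
  sInf {d : ℝ | ∃ w ∈ e, d = ‖x w‖}

/-- SDP value of a vector solution. -/
def sdpValue {V ι H : Type*} [Fintype ι] [NormedAddCommGroup H]
    (ed : ι → Finset V) (x : V → H) : ℝ :=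
  ∑ i : ι, maxDistSq x (ed i)

/-- Expansion of a set `S` in the hypergraph. -/
def expansion {V ι : Type*} [Fintype V] [DecidableEq V] [Fintype ι]
    (ed : ι → Finset V) (S : Finset V) : ℝ :=
  (cutCount ed S : ℝ) / min (S.card : ℝ) ((Sᶜ : Finset V).card : ℝ)

/-- Small set expansion `φ*_{H,δ}`. -/
def phiStar {V ι : Type*} [Fintype V] [DecidableEq V] [Fintype ι]
    (ed : ι → Finset V) (δ : ℝ) : ℝ :=
  sInf {c : ℝ | ∃ S : Finset V, S.Nonempty ∧ (S.card : ℝ) ≤ δ * Fintype.card V ∧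
                c = expansion ed S}

/-- Feasibility for the SDP relaxation of H-SSE with parameter `δ`. -/
def SDPFeasible {V H : Type*} [Fintype V] [NormedAddCommGroup H] [InnerProductSpace ℝ H]
    (x : V → H) (δ : ℝ) : Prop :=
  (∀ u : V, ∑ v : V, (⟪x u, x v⟫ : ℝ) ≤ δ * (Fintype.card V : ℝ) * ‖x u‖ ^ 2) ∧
  (∑ u : V, ‖x u‖ ^ 2 = 1) ∧
  (∀ u v w : V, ‖x u - x w‖ ^ 2 ≤ ‖x u - x v‖ ^ 2 + ‖x v - x w‖ ^ 2) ∧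
  (∀ u v : V, 0 ≤ (⟪x u, x v⟫ : ℝ) ∧ (⟪x u, x v⟫ : ℝ) ≤ ‖x u‖ ^ 2)

/-- The `ℓ2²`-triangle inequalities for a family of vectors. -/
def L22 {V H : Type*} [NormedAddCommGroup H] [InnerProductSpace ℝ H] (x : V → H) : Prop :=
  (∀ u v w : V, ‖x u - x w‖ ^ 2 ≤ ‖x u - x v‖ ^ 2 + ‖x v - x w‖ ^ 2) ∧
  (∀ u v : V, 0 ≤ (⟪x u, x v⟫ : ℝ) ∧ (⟪x u, x v⟫ : ℝ) ≤ ‖x u‖ ^ 2)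

/-- Probability of an event under a finitely supported distribution. -/
def Pr {Ω : Type*} [Fintype Ω] (μ : Ω → ℝ) (P : Ω → Prop) : ℝ :=
  ∑ ω : Ω, if P ω then μ ω else 0

/-- A finitely supported probability distribution. -/
def IsProbDist {Ω : Type*} [Fintype Ω] (μ : Ω → ℝ) : Prop :=
  (∀ ω, 0 ≤ μ ω) ∧ ∑ ω : Ω, μ ω = 1

/-- `η(u)` for a choice `c` of subsets `e° ⊆ e`. -/
def eta {V ι : Type*} [Fintype ι] (ed c : ι → Finset V) (u : V) : ℝ :=
  ∑ i : ι, if u ∈ c i then Real.logb 2 ((ed i).card) / ((c i).card : ℝ) else 0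

/-- `η̂(H)`: the minimum over all valid choices `(e°)_{e∈E}` of `max_{u∈V} η(u)`. -/
def etaHat {V ι : Type*} [Fintype V] [Fintype ι] (ed : ι → Finset V) : ℝ :=
  sInf {b : ℝ | ∃ c : ι → Finset V, (∀ i, c i ⊆ ed i ∧ (c i).Nonempty) ∧
                b = ⨆ u : V, eta ed c u}

/-- Hypergraph `m`-orthogonal separator with distortion `D`, probability scale `α`,
separation threshold `β`. -/
def IsHOrthSep {V H : Type*} [Fintype V] [DecidableEq V]
    [NormedAddCommGroup H] [InnerProductSpace ℝ H]
    (x : V → H) (m β α D : ℝ) (μ : Finset V → ℝ) : Prop :=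
  (∀ u : V, Pr μ (fun S => u ∈ S) = α * ‖x u‖ ^ 2) ∧
  (∀ u v : V, β * min (‖x u‖ ^ 2) (‖x v‖ ^ 2) ≤ ‖x u - x v‖ ^ 2 →
    Pr μ (fun S => u ∈ S ∧ v ∈ S) ≤ α * min (‖x u‖ ^ 2) (‖x v‖ ^ 2) / m) ∧
  (∀ e : Finset V, Pr μ (fun S => Cuts S e) ≤ α * D * maxDistSq x e)

/-- Von Neumann's minimax theorem for a finite zero-sum game. -/
theorem exists_mixed_strategy {I J : Type*} [Fintype I] [Fintype J] [Nonempty J]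
    (A : I → J → ℝ) (p : ℝ)
    (h : ∀ w : I → ℝ, IsProbDist w → ∃ j, p ≤ ∑ i, w i * A i j) :
    ∃ q : J → ℝ, IsProbDist q ∧ ∀ i, p ≤ ∑ j, q j * A i j := by
  by_cases hI : Nonempty I
  swap
  · refine ⟨Pi.single (Classical.arbitrary J) 1, ⟨fun j => ?_, by simp⟩, fun i => (hI ⟨i⟩).elim⟩
    by_cases hj : j = Classical.arbitrary J
    · subst hj; simp
    · simp [hj]
  let f : (I → ℝ) → (J → ℝ) → ℝ := fun x y => ∑ i, ∑ j, x i * y j * A i j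
  have hlin1 : ∀ y, IsLinearMap ℝ fun x => f x y := fun y =>
    { map_add := fun x x' => by
        simp only [f, ← Finset.sum_add_distrib]
        refine Finset.sum_congr rfl fun i _ => Finset.sum_congr rfl fun j _ => ?_
        simp only [Pi.add_apply]; ring
      map_smul := fun c x => by
        simp only [f, Finset.smul_sum]
        refine Finset.sum_congr rfl fun i _ => Finset.sum_congr rfl fun j _ => ?_
        simp only [Pi.smul_apply, smul_eq_mul]; ring }
  have hlin2 : ∀ x, IsLinearMap ℝ fun y => f x y := fun x =>
    { map_add := fun y y' => by
        simp only [f, ← Finset.sum_add_distrib]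
        refine Finset.sum_congr rfl fun i _ => Finset.sum_congr rfl fun j _ => ?_
        simp only [Pi.add_apply]; ring
      map_smul := fun c y => by
        simp only [f, Finset.smul_sum]
        refine Finset.sum_congr rfl fun i _ => Finset.sum_congr rfl fun j _ => ?_
        simp only [Pi.smul_apply, smul_eq_mul]; ring }
  have hc1 : ∀ y, Continuous fun x => f x y := fun y => by fun_prop
  have hc2 : ∀ x, Continuous fun y => f x y := fun x => by fun_prop
  obtain ⟨a, ha, b, hb, hab⟩ := Sion.exists_isSaddlePointOn'
    (X := stdSimplex ℝ I) (Y := stdSimplex ℝ J) (f := f)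
    ⟨_, single_mem_stdSimplex ℝ (Classical.arbitrary I)⟩
    (isCompact_stdSimplex ℝ I)
    (fun y _ => (hc1 y).lowerSemicontinuous.lowerSemicontinuousOn _)
    (fun y _ => (((hlin1 y).mk' _).convexOn (convex_stdSimplex ℝ I)).quasiconvexOn)
    (convex_stdSimplex ℝ J) (isCompact_stdSimplex ℝ J)
    (fun x _ => (hc2 x).upperSemicontinuous.upperSemicontinuousOn _)
    (fun x _ => (((hlin2 x).mk' _).concaveOn (convex_stdSimplex ℝ J)).quasiconcaveOn)
    (convex_stdSimplex ℝ I)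
    ⟨_, single_mem_stdSimplex ℝ (Classical.arbitrary J)⟩
  refine ⟨b, hb, fun i => ?_⟩
  obtain ⟨j, hj⟩ := h a ha
  have h1 := hab _ (single_mem_stdSimplex ℝ i) _ (single_mem_stdSimplex ℝ j)
  have e1 : f a (Pi.single j 1) = ∑ i, a i * A i j := by
    simp only [f]
    refine Finset.sum_congr rfl fun i _ => ?_
    rw [Finset.sum_eq_single j] <;> simp +contextual
  have e2 : f (Pi.single i 1) b = ∑ j, b j * A i j := by
    simp only [f]
    rw [Finset.sum_eq_single i] <;> simp +contextual
  linarith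

/-! ### Averages over the discrete cube -/

/-- The sign `±1` encoded by a Boolean. -/
def boolSign (b : Bool) : ℝ := if b then 1 else -1

@[simp] theorem boolSign_true : boolSign true = 1 := rfl
@[simp] theorem boolSign_false : boolSign false = -1 := rfl
@[simp] theorem boolSign_not (b : Bool) : boolSign (!b) = -boolSign b := by cases b <;> simp
@[simp] theorem boolSign_sq (b : Bool) : boolSign b ^ 2 = 1 := by cases b <;> simp

/-- The Rademacher sum with coefficients `a`. -/
def radSum {N : ℕ} (a : Fin N → ℝ) (ε : Fin N → Bool) : ℝ := ∑ i, boolSign (ε i) * a i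

theorem radSum_sub {N : ℕ} (a b : Fin N → ℝ) (ε : Fin N → Bool) :
    radSum (fun i => a i - b i) ε = radSum a ε - radSum b ε := by
  simp [radSum, mul_sub]

theorem radSum_not {N : ℕ} (a : Fin N → ℝ) (ε : Fin N → Bool) :
    radSum a (fun i => !ε i) = -radSum a ε := by
  simp [radSum]

theorem radSum_cons {N : ℕ} (a : Fin (N + 1) → ℝ) (b : Bool) (ε : Fin N → Bool) :
    radSum a (Fin.cons b ε) = boolSign b * a 0 + radSum (Fin.tail a) ε := by
  simp [radSum, Fin.sum_univ_succ, Fin.tail]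

theorem expect_cube_succ {N : ℕ} (f : (Fin (N + 1) → Bool) → ℝ) :
    𝔼 ε, f ε = 𝔼 ε, (f (Fin.cons true ε) + f (Fin.cons false ε)) / 2 := by
  simp only [Fintype.expect_eq_sum_div_card]
  rw [← (Fin.consEquiv fun _ : Fin (N + 1) => Bool).sum_comp, Fintype.sum_prod_type]
  simp only [Fintype.sum_bool, ← Finset.sum_add_distrib, ← Finset.sum_div]
  simp [pow_succ]
  field_simp
  rfl

theorem expect_cube_not {N : ℕ} (f : (Fin N → Bool) → ℝ) :
    𝔼 ε : Fin N → Bool, f (fun i => !ε i) = 𝔼 ε, f ε :=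
  Fintype.expect_equiv (Equiv.piCongrRight fun _ => Equiv.boolNot) _ _ fun _ => rfl

theorem expect_radSum_sq {N : ℕ} (a : Fin N → ℝ) :
    𝔼 ε, radSum a ε ^ 2 = ∑ i, a i ^ 2 := by
  induction N with
  | zero => simp [radSum]
  | succ N ih =>
    rw [expect_cube_succ, Fin.sum_univ_succ]
    simp only [radSum_cons]
    have : ∀ ε, ((boolSign true * a 0 + radSum (Fin.tail a) ε) ^ 2 +
        (boolSign false * a 0 + radSum (Fin.tail a) ε) ^ 2) / 2 =
        a 0 ^ 2 + radSum (Fin.tail a) ε ^ 2 := fun ε => by simp; ring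
    simp only [this, Finset.expect_add_distrib, ih, Fintype.expect_const]
    rfl

theorem expect_radSum_pow_four_le {N : ℕ} (a : Fin N → ℝ) :
    𝔼 ε, radSum a ε ^ 4 ≤ 3 * (∑ i, a i ^ 2) ^ 2 := by
  induction N with
  | zero => simp [radSum]
  | succ N ih =>
    rw [expect_cube_succ, Fin.sum_univ_succ]
    simp only [radSum_cons]
    have : ∀ ε, ((boolSign true * a 0 + radSum (Fin.tail a) ε) ^ 4 +
        (boolSign false * a 0 + radSum (Fin.tail a) ε) ^ 4) / 2 =
        a 0 ^ 4 + 6 * a 0 ^ 2 * radSum (Fin.tail a) ε ^ 2 + radSum (Fin.tail a) ε ^ 4 :=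
      fun ε => by simp; ring
    simp only [this, Finset.expect_add_distrib, ← Finset.mul_expect, expect_radSum_sq,
      Fintype.expect_const]
    have := ih (Fin.tail a)
    simp only [Fin.tail] at this ⊢
    nlinarith [sq_nonneg (a 0 ^ 2)]

theorem expect_exp_radSum_le {N : ℕ} (a : Fin N → ℝ) :
    𝔼 ε, Real.exp (radSum a ε) ≤ Real.exp ((∑ i, a i ^ 2) / 2) := by
  induction N with
  | zero => simp [radSum]
  | succ N ih =>
    rw [expect_cube_succ, Fin.sum_univ_succ]
    simp only [radSum_cons]
    have : ∀ ε, (Real.exp (boolSign true * a 0 + radSum (Fin.tail a) ε) +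
        Real.exp (boolSign false * a 0 + radSum (Fin.tail a) ε)) / 2 =
        Real.cosh (a 0) * Real.exp (radSum (Fin.tail a) ε) :=
      fun ε => by simp [Real.exp_add, Real.cosh_eq]; ring
    simp only [this, ← Finset.mul_expect]
    rw [add_div, Real.exp_add]
    exact mul_le_mul (Real.cosh_le_exp_half_sq _) (ih (Fin.tail a))
      (Finset.expect_nonneg fun _ _ => (Real.exp_pos _).le) (Real.exp_pos _).le

/-- The one-sided discrete gradient, squared. -/
def upGradSq {N : ℕ} (F : (Fin N → Bool) → ℝ) (ε : Fin N → Bool) : ℝ :=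
  ∑ i, (max (F ε - F (Function.update ε i (!ε i))) 0) ^ 2

theorem sq_expect_le {Ω : Type*} [Fintype Ω] (f : Ω → ℝ) : (𝔼 ω, f ω) ^ 2 ≤ 𝔼 ω, f ω ^ 2 := by
  cases isEmpty_or_nonempty Ω
  · simp
  have h : 0 ≤ 𝔼 ω, (f ω - 𝔼 ω, f ω) ^ 2 := Finset.expect_nonneg fun _ _ => sq_nonneg _
  have h2 : ∀ ω, (f ω - 𝔼 ω, f ω) ^ 2 = f ω ^ 2 - (2 * 𝔼 ω, f ω) * f ω + (𝔼 ω, f ω) ^ 2 :=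
    fun ω => by ring
  simp only [h2, Finset.expect_add_distrib, Finset.expect_sub_distrib, ← Finset.mul_expect,
    Fintype.expect_const] at h
  linarith

theorem max_half_add_sq_le (a b : ℝ) :
    (max ((a + b) / 2) 0) ^ 2 ≤ ((max a 0) ^ 2 + (max b 0) ^ 2) / 2 := by
  have h : max ((a + b) / 2) 0 ≤ (max a 0 + max b 0) / 2 :=
    max_le (by linarith [le_max_left a 0, le_max_left b 0])
      (by linarith [le_max_right a 0, le_max_right b 0])
  have h0 : 0 ≤ max ((a + b) / 2) 0 := le_max_right _ _
  nlinarith [sq_nonneg (max a 0 - max b 0)]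

theorem max_sub_sq_add (a b : ℝ) : (max (a - b) 0) ^ 2 + (max (b - a) 0) ^ 2 = (a - b) ^ 2 := by
  rcases le_total a b with h | h
  · rw [max_eq_right (by linarith), max_eq_left (by linarith)]; ring
  · rw [max_eq_left (by linarith), max_eq_right (by linarith)]; ring

/-- The Efron-Stein (Poincaré) inequality on the discrete cube. -/
theorem cube_poincare {N : ℕ} (F : (Fin N → Bool) → ℝ) :
    𝔼 ε, F ε ^ 2 - (𝔼 ε, F ε) ^ 2 ≤ (𝔼 ε, upGradSq F ε) / 2 := by
  induction N with
  | zero => simp [upGradSq]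
  | succ N ih =>
    rw [expect_cube_succ, expect_cube_succ F, expect_cube_succ (upGradSq F)]
    set P : (Fin N → Bool) → ℝ := fun ε => F (Fin.cons true ε) with hP
    set Q : (Fin N → Bool) → ℝ := fun ε => F (Fin.cons false ε) with hQ
    have hup : ∀ ε, upGradSq F (Fin.cons true ε) + upGradSq F (Fin.cons false ε) =
        (P ε - Q ε) ^ 2 + (upGradSq P ε + upGradSq Q ε) := fun ε => by
      simp only [upGradSq, Fin.sum_univ_succ, Fin.cons_zero, Fin.cons_succ, Fin.update_cons_zero,
        ← Fin.cons_update, Bool.not_true, Bool.not_false]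
      rw [← max_sub_sq_add (P ε) (Q ε)]
      simp only [hP, hQ]
      ring
    have hG : ∀ ε, upGradSq (fun ε => (P ε + Q ε) / 2) ε ≤ (upGradSq P ε + upGradSq Q ε) / 2 :=
      fun ε => by
        simp only [upGradSq, ← Finset.sum_add_distrib, Finset.sum_div]
        refine Finset.sum_le_sum fun i _ => ?_
        have e : (P ε + Q ε) / 2 -
            (P (Function.update ε i (!ε i)) + Q (Function.update ε i (!ε i))) / 2 =
            ((P ε - P (Function.update ε i (!ε i))) + (Q ε - Q (Function.update ε i (!ε i)))) / 2 := by
          ring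
        rw [e]
        exact max_half_add_sq_le _ _
    have h1 := ih fun ε => (P ε + Q ε) / 2
    have h2 : 𝔼 ε, upGradSq (fun ε => (P ε + Q ε) / 2) ε ≤
        𝔼 ε, (upGradSq P ε + upGradSq Q ε) / 2 := Finset.expect_le_expect fun ε _ => hG ε
    have h3 : 𝔼 ε, (P ε ^ 2 + Q ε ^ 2) / 2 =
        𝔼 ε, ((P ε + Q ε) / 2) ^ 2 + 𝔼 ε, ((P ε - Q ε) ^ 2) / 4 := by
      rw [← Finset.expect_add_distrib]
      exact Finset.expect_congr rfl fun ε _ => by ring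
    have h4 : 𝔼 ε, (upGradSq F (Fin.cons true ε) + upGradSq F (Fin.cons false ε)) / 2 =
        2 * 𝔼 ε, ((P ε - Q ε) ^ 2) / 4 + 𝔼 ε, (upGradSq P ε + upGradSq Q ε) / 2 := by
      rw [Finset.mul_expect, ← Finset.expect_add_distrib]
      exact Finset.expect_congr rfl fun ε _ => by rw [hup]; ring
    rw [h3, h4]
    linarith

/-! ### Maxima of Rademacher processes over balls -/

/-- Squared Euclidean distance between the points of the family `y`. -/
def sqDist {V : Type*} {N : ℕ} (y : V → Fin N → ℝ) (u v : V) : ℝ := ∑ i, (y u i - y v i) ^ 2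

theorem sqDist_nonneg {V : Type*} {N : ℕ} (y : V → Fin N → ℝ) (u v : V) : 0 ≤ sqDist y u v :=
  Finset.sum_nonneg fun _ _ => sq_nonneg _

theorem sqDist_self {V : Type*} {N : ℕ} (y : V → Fin N → ℝ) (u : V) : sqDist y u u = 0 := by
  simp [sqDist]

theorem sqDist_comm {V : Type*} {N : ℕ} (y : V → Fin N → ℝ) (u v : V) :
    sqDist y u v = sqDist y v u :=
  Finset.sum_congr rfl fun _ _ => by ring

/-- The maximal displacement of a Rademacher projection on the ball of radius `r` around `u`. -/
def procMax {V : Type*} [Fintype V] {N : ℕ} (y : V → Fin N → ℝ) (r : ℝ) (u : V)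
    (ε : Fin N → Bool) : ℝ :=
  (insert u (Finset.univ.filter fun v => sqDist y u v ≤ r)).sup' (Finset.insert_nonempty _ _)
    fun v => radSum (y v) ε - radSum (y u) ε

section procMax

variable {V : Type*} [Fintype V] {N : ℕ} {y : V → Fin N → ℝ}

theorem procMax_nonneg (r : ℝ) (u : V) (ε : Fin N → Bool) : 0 ≤ procMax y r u ε := by
  have := Finset.le_sup' (fun v => radSum (y v) ε - radSum (y u) ε)
    (Finset.mem_insert_self u (Finset.univ.filter fun v => sqDist y u v ≤ r))
  rwa [sub_self] at this

theorem le_procMax {r : ℝ} {u v : V} (h : sqDist y u v ≤ r) (ε : Fin N → Bool) :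
    radSum (y v) ε - radSum (y u) ε ≤ procMax y r u ε :=
  Finset.le_sup' (fun v => radSum (y v) ε - radSum (y u) ε) (by simp [h])

theorem exists_procMax_eq {r : ℝ} (hr : 0 ≤ r) (u : V) (ε : Fin N → Bool) :
    ∃ v, sqDist y u v ≤ r ∧ procMax y r u ε = radSum (y v) ε - radSum (y u) ε := by
  obtain ⟨v, hv, h⟩ := Finset.exists_mem_eq_sup' (Finset.insert_nonempty u
    (Finset.univ.filter fun v => sqDist y u v ≤ r)) fun v => radSum (y v) ε - radSum (y u) ε
  refine ⟨v, ?_, h⟩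
  simp only [Finset.mem_insert, Finset.mem_filter, Finset.mem_univ, true_and] at hv
  rcases hv with rfl | hv
  · rwa [sqDist_self]
  · exact hv

theorem procMax_mono {r r' : ℝ} (hr : 0 ≤ r) (h : r ≤ r') (u : V) (ε : Fin N → Bool) :
    procMax y r u ε ≤ procMax y r' u ε := by
  obtain ⟨v, hv, e⟩ := exists_procMax_eq hr u ε
  rw [e]
  exact le_procMax (hv.trans h) ε

theorem add_procMax_le (htri : ∀ u v w, sqDist y u w ≤ sqDist y u v + sqDist y v w)
    {r δ : ℝ} (hr : 0 ≤ r) {u v : V} (h : sqDist y u v ≤ δ) (ε : Fin N → Bool) :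
    radSum (y v) ε - radSum (y u) ε + procMax y r v ε ≤ procMax y (r + δ) u ε := by
  obtain ⟨z, hz, e⟩ := exists_procMax_eq hr v ε
  have := le_procMax (y := y) (r := r + δ) (u := u) (v := z) (by linarith [htri u v z]) ε
  linarith

theorem upGradSq_procMax_le {r : ℝ} (hr : 0 ≤ r) (u : V) (ε : Fin N → Bool) :
    upGradSq (procMax y r u) ε ≤ 4 * r := by
  obtain ⟨v, hv, e⟩ := exists_procMax_eq hr u ε
  have hsum : 4 * sqDist y u v ≤ 4 * r := by linarith
  refine le_trans ?_ hsum
  rw [upGradSq, sqDist, Finset.mul_sum]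
  refine Finset.sum_le_sum fun i _ => ?_
  set ε' := Function.update ε i (!ε i) with hε'
  have key : ∀ a : Fin N → ℝ, radSum a ε - radSum a ε' = 2 * boolSign (ε i) * a i := fun a => by
    rw [radSum, radSum, ← Finset.sum_sub_distrib, Finset.sum_eq_single i]
    · simp [hε']; ring
    · intro j _ hj
      simp [hε', hj]
    · simp
  have h1 := le_procMax hv ε'
  have h2 : procMax y r u ε - procMax y r u ε' ≤ 2 * boolSign (ε i) * (y v i - y u i) := by
    have := key (y v); have := key (y u)
    linarith
  have h3 : max (procMax y r u ε - procMax y r u ε') 0 ≤ 2 * |y v i - y u i| := by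
    refine max_le (h2.trans ?_) (by positivity)
    cases ε i
    · simp; linarith [neg_abs_le (y v i - y u i)]
    · simp; linarith [le_abs_self (y v i - y u i)]
  have h4 : 0 ≤ max (procMax y r u ε - procMax y r u ε') 0 := le_max_right _ _
  calc _ ≤ (2 * |y v i - y u i|) ^ 2 := pow_le_pow_left₀ h4 h3 2
    _ = 4 * (y u i - y v i) ^ 2 := by rw [mul_pow, sq_abs]; ring

theorem expect_abs_procMax_sub_le {r : ℝ} (hr : 0 ≤ r) (u : V) :
    𝔼 ε, |procMax y r u ε - 𝔼 ε, procMax y r u ε| ≤ √(2 * r) := by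
  set Y := procMax y r u
  apply Real.le_sqrt_of_sq_le
  refine (sq_expect_le _).trans ?_
  have h1 := cube_poincare Y
  have h2 : 𝔼 ε, upGradSq Y ε ≤ 4 * r :=
    Finset.expect_le Finset.univ_nonempty fun ε _ => upGradSq_procMax_le hr u ε
  have h3 : ∀ ε, |Y ε - 𝔼 ε, Y ε| ^ 2 = Y ε ^ 2 - (2 * 𝔼 ε, Y ε) * Y ε + (𝔼 ε, Y ε) ^ 2 :=
    fun ε => by rw [sq_abs]; ring
  simp only [h3, Finset.expect_add_distrib, Finset.expect_sub_distrib, ← Finset.mul_expect,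
    Fintype.expect_const]
  linarith

theorem mul_expect_procMax_le {r : ℝ} (hr : 0 ≤ r) (l : ℝ) (u : V) :
    l * 𝔼 ε, procMax y r u ε ≤ Real.log (Fintype.card V) + l ^ 2 * r / 2 := by
  have hV : 0 < (Fintype.card V : ℝ) := by
    exact_mod_cast Fintype.card_pos_iff.2 ⟨u⟩
  set c := Real.log (Fintype.card V) + l ^ 2 * r / 2 with hc
  have hpt : ∀ ε, l * procMax y r u ε - c + 1 ≤ Real.exp (-c) *
      ∑ v ∈ Finset.univ.filter (fun v => sqDist y u v ≤ r),
        Real.exp (radSum (fun i => l * (y v i - y u i)) ε) := fun ε => by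
    obtain ⟨v, hv, e⟩ := exists_procMax_eq hr u ε
    have e1 : l * procMax y r u ε = radSum (fun i => l * (y v i - y u i)) ε := by
      rw [e, ← radSum_sub, radSum, radSum, Finset.mul_sum]
      exact Finset.sum_congr rfl fun i _ => by ring
    have h1 := Real.add_one_le_exp (l * procMax y r u ε - c)
    have h2 : Real.exp (l * procMax y r u ε - c) =
        Real.exp (-c) * Real.exp (radSum (fun i => l * (y v i - y u i)) ε) := by
      rw [← Real.exp_add, e1]; ring_nf
    rw [h2] at h1
    refine h1.trans (mul_le_mul_of_nonneg_left ?_ (Real.exp_pos _).le)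
    exact Finset.single_le_sum (f := fun v => Real.exp (radSum (fun i => l * (y v i - y u i)) ε))
      (fun _ _ => (Real.exp_pos _).le) (by simp [hv])
  have h := Finset.expect_le_expect (s := Finset.univ) fun ε _ => hpt ε
  simp only [Finset.expect_add_distrib, Finset.expect_sub_distrib, ← Finset.mul_expect,
    Fintype.expect_const, Finset.expect_sum_comm] at h
  have h5 : ∑ v ∈ Finset.univ.filter (fun v => sqDist y u v ≤ r),
      𝔼 ε, Real.exp (radSum (fun i => l * (y v i - y u i)) ε) ≤ Real.exp c := by
    calc _ ≤ ∑ v ∈ Finset.univ.filter (fun v => sqDist y u v ≤ r), Real.exp (l ^ 2 * r / 2) := by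
          refine Finset.sum_le_sum fun v hv => (expect_exp_radSum_le _).trans ?_
          simp only [Finset.mem_filter, Finset.mem_univ, true_and] at hv
          rw [Real.exp_le_exp]
          have : ∑ i, (l * (y v i - y u i)) ^ 2 = l ^ 2 * sqDist y u v := by
            rw [sqDist, Finset.mul_sum]
            exact Finset.sum_congr rfl fun i _ => by ring
          rw [this]
          have := mul_le_mul_of_nonneg_left hv (sq_nonneg l)
          linarith
      _ ≤ Fintype.card V * Real.exp (l ^ 2 * r / 2) := by
          rw [Finset.sum_const, nsmul_eq_mul]
          gcongr
          exact Finset.card_le_univ _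
      _ = Real.exp c := by rw [hc, Real.exp_add, Real.exp_log hV]
  have h6 := mul_le_mul_of_nonneg_left h5 (Real.exp_pos (-c)).le
  rw [← Real.exp_add, neg_add_cancel, Real.exp_zero] at h6
  linarith

/-- One chaining step: fractional matchings of close points along which Rademacher projections
increase by `σ` force the average maximal displacement to grow. -/
theorem chaining_step (htri : ∀ u v w, sqDist y u w ≤ sqDist y u v + sqDist y v w)
    {μ : V → ℝ} (hμ : IsProbDist μ) {M : (Fin N → Bool) → V → V → ℝ} {δ σ P r : ℝ}
    (hM0 : ∀ ε u v, 0 ≤ M ε u v) (hMsymm : ∀ ε u v, M (fun i => !ε i) v u = M ε u v)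
    (hMrow : ∀ ε u, ∑ v, M ε u v ≤ μ u)
    (hMsupp : ∀ ε u v, M ε u v ≠ 0 →
      sqDist y u v ≤ δ ∧ σ ≤ radSum (y v) ε - radSum (y u) ε)
    (hδ : 0 ≤ δ) (hσ : 0 ≤ σ) (hP : P ≤ 𝔼 ε, ∑ u, ∑ v, M ε u v) (hr : 0 ≤ r) :
    ∑ u, μ u * 𝔼 ε, procMax y r u ε + σ * P - √(2 * r) ≤
      ∑ u, μ u * 𝔼 ε, procMax y (r + δ) u ε := by
  have hcol : ∀ ε v, ∑ u, M ε u v = ∑ u, M (fun i => !ε i) v u := fun ε v =>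
    Finset.sum_congr rfl fun u _ => (hMsymm ε u v).symm
  have hpt : ∀ ε, ∑ u, μ u * procMax y r u ε + σ * ∑ u, ∑ v, M ε u v +
      ∑ u, (∑ v, M ε v u - ∑ v, M ε u v) * procMax y r u ε ≤
      ∑ u, μ u * procMax y (r + δ) u ε := fun ε => by
    have hedge : ∀ u v, M ε u v * (σ + procMax y r v ε) ≤ M ε u v * procMax y (r + δ) u ε := by
      intro u v
      by_cases h : M ε u v = 0
      · simp [h]
      · obtain ⟨h1, h2⟩ := hMsupp ε u v h
        exact mul_le_mul_of_nonneg_left (by linarith [add_procMax_le htri hr h1 ε]) (hM0 _ _ _)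
    have h1 : ∑ u, ∑ v, M ε u v * (σ + procMax y r v ε) ≤
        ∑ u, (∑ v, M ε u v) * procMax y (r + δ) u ε :=
      Finset.sum_le_sum fun u _ => by
        rw [Finset.sum_mul]
        exact Finset.sum_le_sum fun v _ => hedge u v
    have h2 : ∑ u, (μ u - ∑ v, M ε u v) * procMax y r u ε ≤
        ∑ u, (μ u - ∑ v, M ε u v) * procMax y (r + δ) u ε :=
      Finset.sum_le_sum fun u _ => mul_le_mul_of_nonneg_left
        (procMax_mono hr (by linarith) u ε) (by linarith [hMrow ε u])
    have h3 : ∑ u, ∑ v, M ε u v * (σ + procMax y r v ε) =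
        σ * ∑ u, ∑ v, M ε u v + ∑ u, (∑ v, M ε v u) * procMax y r u ε := by
      simp only [mul_add, Finset.sum_add_distrib]
      congr 1
      · simp only [Finset.mul_sum]
        exact Finset.sum_congr rfl fun _ _ => Finset.sum_congr rfl fun _ _ => mul_comm _ _
      · rw [Finset.sum_comm]
        exact Finset.sum_congr rfl fun _ _ => by rw [Finset.sum_mul]
    simp only [sub_mul, Finset.sum_sub_distrib] at h2 ⊢
    linarith
  have hexp := Finset.expect_le_expect (s := Finset.univ) fun ε _ => hpt ε
  simp only [Finset.expect_add_distrib, Finset.expect_sum_comm, ← Finset.mul_expect] at hexp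
  have hfluct : ∀ u, -(μ u * √(2 * r)) ≤
      𝔼 ε, (∑ v, M ε v u - ∑ v, M ε u v) * procMax y r u ε := fun u => by
    set f := 𝔼 ε, procMax y r u ε with hf
    have hzero : 𝔼 ε, (∑ v, M ε v u - ∑ v, M ε u v) = 0 := by
      rw [Finset.expect_sub_distrib, sub_eq_zero]
      simp only [hcol]
      exact expect_cube_not fun ε => ∑ v, M ε u v
    have e : 𝔼 ε, (∑ v, M ε v u - ∑ v, M ε u v) * procMax y r u ε =
        𝔼 ε, (∑ v, M ε v u - ∑ v, M ε u v) * (procMax y r u ε - f) := by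
      simp only [mul_sub _ _ f, Finset.expect_sub_distrib, ← Finset.expect_mul, hzero]
      simp
    rw [e]
    have h1 : 𝔼 ε, -(μ u * |procMax y r u ε - f|) ≤
        𝔼 ε, (∑ v, M ε v u - ∑ v, M ε u v) * (procMax y r u ε - f) := by
      refine Finset.expect_le_expect fun ε _ => ?_
      have ha : |∑ v, M ε v u - ∑ v, M ε u v| ≤ μ u := by
        have a1 := hMrow ε u
        have a2 := hMrow (fun i => !ε i) u
        have a3 : 0 ≤ ∑ v, M ε u v := Finset.sum_nonneg fun v _ => hM0 _ _ _
        have a4 : 0 ≤ ∑ v, M ε v u := Finset.sum_nonneg fun v _ => hM0 _ _ _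
        rw [← hcol] at a2
        rw [abs_le]
        constructor <;> linarith
      refine le_trans ?_ (neg_abs_le _)
      rw [abs_mul, neg_le_neg_iff]
      exact mul_le_mul_of_nonneg_right ha (abs_nonneg _)
    refine le_trans ?_ h1
    rw [Finset.expect_neg_distrib, ← Finset.mul_expect, neg_le_neg_iff]
    exact mul_le_mul_of_nonneg_left (expect_abs_procMax_sub_le hr u) (hμ.1 u)
  have hsum := Finset.sum_le_sum (s := Finset.univ) fun u _ => hfluct u
  rw [Finset.sum_neg_distrib, ← Finset.sum_mul, hμ.2, one_mul] at hsum
  have hPs := mul_le_mul_of_nonneg_left hP hσ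
  simp only [Finset.expect_sum_comm] at hPs
  linarith

theorem chaining_contradiction (htri : ∀ u v w, sqDist y u w ≤ sqDist y u v + sqDist y v w)
    {μ : V → ℝ} (hμ : IsProbDist μ) {M : (Fin N → Bool) → V → V → ℝ} {δ σ P c L : ℝ}
    (hM0 : ∀ ε u v, 0 ≤ M ε u v) (hMsymm : ∀ ε u v, M (fun i => !ε i) v u = M ε u v)
    (hMrow : ∀ ε u, ∑ v, M ε u v ≤ μ u)
    (hMsupp : ∀ ε u v, M ε u v ≠ 0 →
      sqDist y u v ≤ δ ∧ σ ≤ radSum (y v) ε - radSum (y u) ε)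
    (hσ : 0 ≤ σ) (hP : P ≤ 𝔼 ε, ∑ u, ∑ v, M ε u v)
    (hc : 0 < c) (hcP : 2 * c ≤ σ * P) (hL1 : 1 ≤ L) (hL : Real.log (Fintype.card V) ≤ L)
    (hδ : δ = c ^ 2 / (4 * √L)) : False := by
  have hsL : 1 ≤ √L := Real.one_le_sqrt.2 hL1
  have hδ0 : 0 < δ := by rw [hδ]; positivity
  have hδc : 4 * δ ≤ c ^ 2 := by
    rw [hδ, ← mul_div_assoc, mul_div_mul_left _ _ (by norm_num)]
    exact div_le_self (by positivity) hsL
  have hδL : 16 * δ ^ 2 * L = c ^ 4 := by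
    have : √L ^ 2 = L := Real.sq_sqrt (by linarith)
    rw [hδ, div_pow, mul_pow, this]
    field_simp
    norm_num
  set K := ⌊c ^ 2 / (2 * δ)⌋₊ with hK
  have hKle : (K : ℝ) * (2 * δ) ≤ c ^ 2 := by
    have := Nat.floor_le (a := c ^ 2 / (2 * δ)) (by positivity)
    rwa [le_div_iff₀ (by positivity)] at this
  have hKge : c ^ 2 ≤ (K : ℝ) * (4 * δ) := by
    have h1 := Nat.lt_floor_add_one (c ^ 2 / (2 * δ))
    rw [div_lt_iff₀ (by positivity)] at h1
    nlinarith
  have hgrow : ∀ k : ℕ, k ≤ K → k * c ≤ ∑ u, μ u * 𝔼 ε, procMax y (k * δ) u ε := by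
    intro k
    induction k with
    | zero =>
      intro _
      simp only [Nat.cast_zero, zero_mul]
      exact Finset.sum_nonneg fun u _ => mul_nonneg (hμ.1 u)
        (Finset.expect_nonneg fun ε _ => procMax_nonneg _ _ _)
    | succ k ih =>
      intro hk
      have h1 := ih (by omega)
      have h2 := chaining_step htri hμ hM0 hMsymm hMrow hMsupp hδ0.le hσ hP
        (r := k * δ) (by positivity)
      have h3 : √(2 * (k * δ)) ≤ c := by
        rw [Real.sqrt_le_left hc.le]
        have : (k : ℝ) ≤ K := by exact_mod_cast (by omega : k ≤ K)
        nlinarith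
      push_cast
      rw [add_mul (k : ℝ) 1 δ, one_mul]
      linarith
  have h1 := hgrow K le_rfl
  have h2 : (c / δ) * ∑ u, μ u * 𝔼 ε, procMax y (K * δ) u ε ≤
      L + (c / δ) ^ 2 * (K * δ) / 2 := by
    calc _ = ∑ u, μ u * ((c / δ) * 𝔼 ε, procMax y (K * δ) u ε) := by
          rw [Finset.mul_sum]
          exact Finset.sum_congr rfl fun _ _ => by ring
      _ ≤ ∑ u, μ u * (L + (c / δ) ^ 2 * (K * δ) / 2) :=
          Finset.sum_le_sum fun u _ => mul_le_mul_of_nonneg_left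
            ((mul_expect_procMax_le (by positivity) _ u).trans (by linarith))
            (hμ.1 u)
      _ = _ := by rw [← Finset.sum_mul, hμ.2, one_mul]
  have h3 := mul_le_mul_of_nonneg_left h1 (a := c / δ) (by positivity)
  have h4 : c / δ * (K * c) - (c / δ) ^ 2 * (K * δ) / 2 = K * c ^ 2 / (2 * δ) := by
    field_simp; ring
  have h5 : (K : ℝ) * c ^ 2 / (2 * δ) ≤ L := by linarith
  rw [div_le_iff₀ (by positivity)] at h5
  have h6 : c ^ 2 * c ^ 2 ≤ c ^ 2 * (K * (4 * δ)) := mul_le_mul_of_nonneg_left hKge (by positivity)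
  have h7 : 0 < c ^ 4 := by positivity
  nlinarith

end procMax

/-! ### Fractional matchings and separated pairs -/

/-- An inclusion-maximal fractional matching: every admissible edge has a saturated endpoint. -/
theorem exists_maximal_fractional_matching {V : Type*} [Fintype V] (μ : V → ℝ) (hμ : ∀ u, 0 ≤ μ u)
    (R : V → V → Prop) :
    ∃ M : V → V → ℝ, (∀ u v, 0 ≤ M u v) ∧ (∀ u v, M u v ≠ 0 → R u v) ∧
      (∀ u, ∑ v, M u v ≤ μ u) ∧ (∀ v, ∑ u, M u v ≤ μ v) ∧
      ∀ u v, R u v → ∑ z, M u z = μ u ∨ ∑ z, M z v = μ v := by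
  let S : Set (V → V → ℝ) := {M | (∀ u v, 0 ≤ M u v) ∧ (∀ u v, ¬ R u v → M u v = 0) ∧
    (∀ u, ∑ v, M u v ≤ μ u) ∧ ∀ v, ∑ u, M u v ≤ μ v}
  have hclosed : IsClosed S := by
    simp only [S, Set.ofPred_and, Set.ofPred_forall]
    refine IsClosed.inter ?_ (IsClosed.inter ?_ (IsClosed.inter ?_ ?_))
    · exact isClosed_iInter fun u => isClosed_iInter fun v =>
        isClosed_le continuous_const (by fun_prop)
    · exact isClosed_iInter fun u => isClosed_iInter fun v => isClosed_iInter fun _ =>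
        isClosed_eq (by fun_prop) continuous_const
    · exact isClosed_iInter fun u => isClosed_le (by fun_prop) continuous_const
    · exact isClosed_iInter fun u => isClosed_le (by fun_prop) continuous_const
  have hsub : S ⊆ Set.Icc 0 fun u _ => μ u := fun M hM =>
    ⟨fun u v => hM.1 u v, fun u v =>
      (Finset.single_le_sum (f := M u) (fun v _ => hM.1 u v) (Finset.mem_univ v)).trans (hM.2.2.1 u)⟩
  have hcompact : IsCompact S := isCompact_Icc.of_isClosed_subset hclosed hsub
  have hne : S.Nonempty := ⟨0, by simpa [S] using hμ⟩
  obtain ⟨M, hM, hmax⟩ := hcompact.exists_isMaxOn hne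
    (f := fun M : V → V → ℝ => ∑ u, ∑ v, M u v) (by fun_prop)
  refine ⟨M, hM.1, fun u v h => by_contra fun h' => h (hM.2.1 u v h'), hM.2.2.1, hM.2.2.2,
    fun a b hab => ?_⟩
  by_contra! hcon
  have h1 : ∑ z, M a z < μ a := lt_of_le_of_ne (hM.2.2.1 a) hcon.1
  have h2 : ∑ z, M z b < μ b := lt_of_le_of_ne (hM.2.2.2 b) hcon.2
  obtain ⟨t, ht0, ht1, ht2⟩ : ∃ t : ℝ, 0 < t ∧ t ≤ μ a - ∑ z, M a z ∧ t ≤ μ b - ∑ z, M z b :=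
    ⟨min (μ a - ∑ z, M a z) (μ b - ∑ z, M z b), lt_min (by linarith) (by linarith),
      min_le_left _ _, min_le_right _ _⟩
  let E : V → V → ℝ := fun u v => if u = a ∧ v = b then t else 0
  have hErow : ∀ u, ∑ v, E u v = if u = a then t else 0 := fun u => by
    by_cases h : u = a <;> simp [E, h]
  have hEcol : ∀ v, ∑ u, E u v = if v = b then t else 0 := fun v => by
    by_cases h : v = b <;> simp [E, h]
  have hE0 : ∀ u v, 0 ≤ E u v := fun u v => by
    simp only [E]; split_ifs <;> linarith
  have hmem : (fun u v => M u v + E u v) ∈ S := by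
    refine ⟨fun u v => add_nonneg (hM.1 u v) (hE0 u v), fun u v h => ?_, fun u => ?_, fun v => ?_⟩
    · have : ¬ (u = a ∧ v = b) := by rintro ⟨rfl, rfl⟩; exact h hab
      simp [hM.2.1 u v h, E, this]
    · rw [Finset.sum_add_distrib, hErow]
      split_ifs with h
      · subst h; linarith
      · simpa using hM.2.2.1 u
    · rw [Finset.sum_add_distrib, hEcol]
      split_ifs with h
      · subst h; linarith
      · simpa using hM.2.2.2 v
  have h3 : ∑ u, ∑ v, (M u v + E u v) ≤ ∑ u, ∑ v, M u v := hmax hmem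
  simp only [Finset.sum_add_distrib, hErow, Finset.sum_ite_eq', Finset.mem_univ, if_true] at h3
  linarith

theorem one_sixth_le_expect_half_le_abs_radSum {N : ℕ} (a : Fin N → ℝ) (ha : 1 ≤ ∑ i, a i ^ 2) :
    1 / 6 ≤ 𝔼 ε, (if 1 / 2 ≤ |radSum a ε| then (1 : ℝ) else 0) := by
  set d := ∑ i, a i ^ 2 with hd
  have hd0 : 0 < d := by linarith
  have hpt : ∀ ε, radSum a ε ^ 2 ≤ d / 4 + 1 / (6 * d) * radSum a ε ^ 4 +
      3 / 2 * d * (if 1 / 2 ≤ |radSum a ε| then (1 : ℝ) else 0) := fun ε => by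
    set X := radSum a ε
    have h4 : 0 ≤ 1 / (6 * d) * X ^ 4 := by positivity
    split_ifs with h
    · have : 1 / (6 * d) * X ^ 4 + 3 / 2 * d - X ^ 2 = (X ^ 2 - 3 * d) ^ 2 / (6 * d) := by
        field_simp; ring
      have : 0 ≤ (X ^ 2 - 3 * d) ^ 2 / (6 * d) := by positivity
      linarith
    · push Not at h
      have : X ^ 2 ≤ (1 / 2) ^ 2 := by
        rw [← sq_abs]; exact pow_le_pow_left₀ (abs_nonneg _) h.le 2
      linarith
  have h := Finset.expect_le_expect (s := Finset.univ) fun ε _ => hpt ε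
  simp only [Finset.expect_add_distrib, ← Finset.mul_expect, Fintype.expect_const,
    expect_radSum_sq, ← hd] at h
  have h4 := mul_le_mul_of_nonneg_left (expect_radSum_pow_four_le a)
    (show 0 ≤ 1 / (6 * d) by positivity)
  rw [← hd] at h4
  have e : 1 / (6 * d) * (3 * d ^ 2) = d / 2 := by field_simp; norm_num
  set p := 𝔼 ε, (if 1 / 2 ≤ |radSum a ε| then (1 : ℝ) else 0)
  have : d * (1 / 6) ≤ d * p := by nlinarith
  exact le_of_mul_le_mul_left this hd0

theorem one_tenth_le_expect_spread {N : ℕ} (a b : Fin N → ℝ) (ha : ∑ i, a i ^ 2 ≤ 1)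
    (hb : ∑ i, b i ^ 2 ≤ 1) (hab : 1 ≤ ∑ i, (a i - b i) ^ 2) :
    1 / 10 ≤ 𝔼 ε, (if 1 / 2 ≤ |radSum a ε - radSum b ε| ∧ |radSum a ε| ≤ 10 ∧ |radSum b ε| ≤ 10
      then (1 : ℝ) else 0) := by
  have h := one_sixth_le_expect_half_le_abs_radSum _ hab
  have hbig : ∀ x : ℝ, ¬ |x| ≤ 10 → 1 ≤ x ^ 2 / 100 := fun x hx => by
    push Not at hx
    have : (10 : ℝ) ^ 2 ≤ |x| ^ 2 := pow_le_pow_left₀ (by norm_num) hx.le 2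
    rw [sq_abs] at this
    linarith
  have hpt : ∀ ε, (if 1 / 2 ≤ |radSum (fun i => a i - b i) ε| then (1 : ℝ) else 0) ≤
      (if 1 / 2 ≤ |radSum a ε - radSum b ε| ∧ |radSum a ε| ≤ 10 ∧ |radSum b ε| ≤ 10
      then (1 : ℝ) else 0) + radSum a ε ^ 2 / 100 + radSum b ε ^ 2 / 100 := fun ε => by
    rw [radSum_sub]
    have p1 : 0 ≤ radSum a ε ^ 2 / 100 := by positivity
    have p2 : 0 ≤ radSum b ε ^ 2 / 100 := by positivity
    by_cases h1 : 1 / 2 ≤ |radSum a ε - radSum b ε|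
    · by_cases h2 : |radSum a ε| ≤ 10
      · by_cases h3 : |radSum b ε| ≤ 10
        · simp only [h1, h2, h3, and_self, if_true]; linarith
        · have := hbig _ h3
          simp only [h1, h3, and_false, if_true, if_false]; linarith
      · have := hbig _ h2
        simp only [h1, h2, and_false, false_and, if_true, if_false]; linarith
    · simp only [h1, false_and, if_false]; linarith
  have h2 := Finset.expect_le_expect (s := Finset.univ) fun ε _ => hpt ε
  simp only [Finset.expect_add_distrib, ← Finset.expect_div, expect_radSum_sq] at h2
  linarith

theorem exists_grid_threshold {a b : ℝ} (hab : 1 / 2 ≤ a - b) (hb : |b| ≤ 10) :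
    ∃ j ∈ Finset.Icc (-40 : ℤ) 40, b ≤ j / 4 ∧ (j : ℝ) / 4 + 1 / 4 ≤ a := by
  obtain ⟨h1, h2⟩ := abs_le.1 hb
  have h3 := Int.le_ceil (4 * b)
  have h4 := Int.ceil_lt_add_one (4 * b)
  refine ⟨⌈4 * b⌉, Finset.mem_Icc.2 ⟨?_, ?_⟩, by linarith, by linarith⟩
  · have : (-40 : ℝ) ≤ ⌈4 * b⌉ := by linarith
    exact_mod_cast this
  · exact Int.ceil_le.2 (by push_cast; linarith)

/-- `A` and `B` contain one point each of the pair `u`, `v`. -/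
def Splits {V : Type*} (A B : Finset V) (u v : V) : Prop := (u ∈ A ∧ v ∈ B) ∨ (v ∈ A ∧ u ∈ B)

/-- The distance between the two sides of the separated pairs of the structure theorem. -/
def sepRadius (L : ℝ) : ℝ := (1 / 51840) ^ 2 / (4 * √L)

/-- Indicator that a pair at squared distance at least one is split. -/
def splitInd {V : Type*} {N : ℕ} (y : V → Fin N → ℝ) (A B : Finset V) (q : V × V) : ℝ :=
  if 1 ≤ sqDist y q.1 q.2 → Splits A B q.1 q.2 then 1 else 0

/-- If no pair of `δ`-separated sets splits much of the demand `w`, then the close pairs of points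
whose projections differ support a large fractional matching. -/
theorem exists_matching_of_not_split {V : Type*} [Fintype V] {N : ℕ} (y : V → Fin N → ℝ)
    {w : V × V → ℝ} (hw : IsProbDist w) {δ p : ℝ}
    (hno : ∀ A B : Finset V, (∀ a ∈ A, ∀ b ∈ B, δ < sqDist y a b) →
      ∑ q, w q * splitInd y A B q < p) (ε : Fin N → Bool) (t : ℝ) :
    ∃ M : V → V → ℝ, (∀ u v, 0 ≤ M u v) ∧
      (∀ u v, M u v ≠ 0 → sqDist y u v ≤ δ ∧ 1 / 4 ≤ radSum (y v) ε - radSum (y u) ε) ∧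
      (∀ u, ∑ v, M u v ≤ (∑ v, w (u, v) + ∑ v, w (v, u)) / 2) ∧
      (∀ v, ∑ u, M u v ≤ (∑ u, w (v, u) + ∑ u, w (u, v)) / 2) ∧
      ∑ q, w q * splitInd y (Finset.univ.filter fun v => t + 1 / 4 ≤ radSum (y v) ε)
        (Finset.univ.filter fun u => radSum (y u) ε ≤ t) q - p ≤ 4 * ∑ u, ∑ v, M u v := by
  set μ : V → ℝ := fun u => (∑ v, w (u, v) + ∑ v, w (v, u)) / 2 with hμ
  have hμ0 : ∀ u, 0 ≤ μ u := fun u => by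
    have h1 := Finset.sum_nonneg fun v (_ : v ∈ Finset.univ) => hw.1 (u, v)
    have h2 := Finset.sum_nonneg fun v (_ : v ∈ Finset.univ) => hw.1 (v, u)
    simp only [hμ]; linarith
  set Lo := Finset.univ.filter fun u => radSum (y u) ε ≤ t with hLo
  set Hi := Finset.univ.filter fun v => t + 1 / 4 ≤ radSum (y v) ε with hHi
  obtain ⟨M, hM0, hMs, hMr, hMc, hMx⟩ := exists_maximal_fractional_matching μ hμ0
    fun u v => u ∈ Lo ∧ v ∈ Hi ∧ sqDist y u v ≤ δ
  refine ⟨M, hM0, fun u v h => ?_, hMr, hMc, ?_⟩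
  · obtain ⟨h1, h2, h3⟩ := hMs u v h
    simp only [hLo, hHi, Finset.mem_filter, Finset.mem_univ, true_and] at h1 h2
    exact ⟨h3, by linarith⟩
  set C : V → ℝ := fun z => if ∑ v, M z v = μ z ∨ ∑ u, M u z = μ z then 1 else 0 with hC
  have hC0 : ∀ z, 0 ≤ C z := fun z => by simp only [hC]; split_ifs <;> norm_num
  set A := Hi.filter fun z => C z = 0 with hA
  set B := Lo.filter fun z => C z = 0 with hB
  have hAB := hno A B fun a ha b hb => by
    simp only [hA, hB, Finset.mem_filter] at ha hb
    by_contra! hcl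
    rw [sqDist_comm] at hcl
    rcases hMx b a ⟨hb.1, ha.1, hcl⟩ with h | h
    · have := hb.2; simp [hC, h] at this
    · have := ha.2; simp [hC, h] at this
  have hpt : ∀ q : V × V, splitInd y Hi Lo q ≤ splitInd y A B q + (C q.1 + C q.2) := fun q => by
    have h01 : ∀ z, C z = 0 ∨ C z = 1 := fun z => by simp only [hC]; split_ifs <;> simp
    have hAB0 : 0 ≤ splitInd y A B q := by simp only [splitInd]; split_ifs <;> norm_num
    have hHL1 : splitInd y Hi Lo q ≤ 1 := by simp only [splitInd]; split_ifs <;> norm_num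
    rcases h01 q.1 with h1 | h1
    · rcases h01 q.2 with h2 | h2
      · have : splitInd y Hi Lo q = splitInd y A B q := by
          have hiff : Splits A B q.1 q.2 ↔ Splits Hi Lo q.1 q.2 := by
            simp only [Splits, hA, hB, Finset.mem_filter, h1, h2, and_true]
          simp only [splitInd, hiff]
        rw [this, h1, h2]; simp
      · linarith [hC0 q.1]
    · linarith [hC0 q.2]
  have h1 : ∑ q, w q * splitInd y Hi Lo q ≤
      ∑ q, w q * splitInd y A B q + ∑ q, w q * (C q.1 + C q.2) := by
    rw [← Finset.sum_add_distrib]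
    exact Finset.sum_le_sum fun q _ => by
      rw [← mul_add]; exact mul_le_mul_of_nonneg_left (hpt q) (hw.1 q)
  have h2 : ∑ q, w q * (C q.1 + C q.2) = 2 * ∑ z, μ z * C z := by
    simp only [mul_add, Finset.sum_add_distrib, Fintype.sum_prod_type]
    rw [Finset.sum_comm (f := fun u v => w (u, v) * C v), ← Finset.sum_add_distrib, Finset.mul_sum]
    refine Finset.sum_congr rfl fun z _ => ?_
    rw [← Finset.sum_mul, ← Finset.sum_mul]
    simp only [hμ]; ring
  have h3 : ∑ z, μ z * C z ≤ 2 * ∑ u, ∑ v, M u v := by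
    have : ∑ z, μ z * C z ≤ ∑ z, (∑ v, M z v + ∑ u, M u z) := by
      refine Finset.sum_le_sum fun z _ => ?_
      have r0 := Finset.sum_nonneg fun v (_ : v ∈ Finset.univ) => hM0 z v
      have c0 := Finset.sum_nonneg fun v (_ : v ∈ Finset.univ) => hM0 v z
      simp only [hC]
      split_ifs with h
      · rcases h with h | h <;> linarith
      · linarith
    rw [Finset.sum_add_distrib, Finset.sum_comm (f := fun z u => M u z)] at this
    linarith
  linarith

/-- The structure theorem for `ℓ₂²` metrics, for an arbitrary weighting of the pairs: some pair of
well-separated sets splits a constant fraction of the pairs at squared distance at least one. -/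
theorem exists_separated_pair {V : Type*} [Fintype V] {N : ℕ} (y : V → Fin N → ℝ)
    (hy : ∀ u, ∑ i, y u i ^ 2 ≤ 1) (htri : ∀ u v w, sqDist y u w ≤ sqDist y u v + sqDist y v w)
    {L : ℝ} (hL1 : 1 ≤ L) (hL : Real.log (Fintype.card V) ≤ L)
    {w : V × V → ℝ} (hw : IsProbDist w) :
    ∃ A B : Finset V, (∀ a ∈ A, ∀ b ∈ B, sepRadius L < sqDist y a b) ∧
      1 / 1620 ≤ ∑ q, w q * splitInd y A B q := by
  by_contra! hno
  choose M hM0 hMs hMr hMc hMw using exists_matching_of_not_split y hw hno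
  set μ : V → ℝ := fun u => (∑ v, w (u, v) + ∑ v, w (v, u)) / 2 with hμ
  have hμd : IsProbDist μ := by
    constructor
    · intro u
      have h1 := Finset.sum_nonneg fun v (_ : v ∈ Finset.univ) => hw.1 (u, v)
      have h2 := Finset.sum_nonneg fun v (_ : v ∈ Finset.univ) => hw.1 (v, u)
      simp only [hμ]; linarith
    · have h := hw.2
      rw [Fintype.sum_prod_type] at h
      simp only [hμ]
      rw [← Finset.sum_div, Finset.sum_add_distrib, Finset.sum_comm (f := fun u v => w (v, u)), h]
      norm_num
  set J := Finset.Icc (-40 : ℤ) 40 with hJ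
  have hJc : (J.card : ℝ) = 81 := by simp [hJ]
  set Mb : (Fin N → Bool) → V → V → ℝ := fun ε u v => (∑ j ∈ J, M ε (j / 4) u v) / 81 with hMb
  have hMb0 : ∀ ε u v, 0 ≤ Mb ε u v := fun ε u v =>
    div_nonneg (Finset.sum_nonneg fun j _ => hM0 _ _ _ _) (by norm_num)
  have hMbs : ∀ ε u v, Mb ε u v ≠ 0 →
      sqDist y u v ≤ sepRadius L ∧ 1 / 4 ≤ radSum (y v) ε - radSum (y u) ε := by
    intro ε u v h
    have : ∑ j ∈ J, M ε (j / 4) u v ≠ 0 := fun h' => h (by simp [hMb, h'])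
    obtain ⟨j, _, hj⟩ := Finset.exists_ne_zero_of_sum_ne_zero this
    exact hMs ε _ u v hj
  have havg : ∀ f : ℤ → ℝ, ∀ c, (∀ j, f j ≤ c) → (∑ j ∈ J, f j) / 81 ≤ c := fun f c h => by
    have := Finset.sum_le_card_nsmul J f c fun j _ => h j
    rw [nsmul_eq_mul, hJc] at this
    linarith
  have hMbr : ∀ ε u, ∑ v, Mb ε u v ≤ μ u := fun ε u => by
    simp only [hMb]
    rw [← Finset.sum_div, Finset.sum_comm]
    exact havg _ _ fun j => hMr ε _ u
  have hMbc : ∀ ε v, ∑ u, Mb ε u v ≤ μ v := fun ε v => by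
    simp only [hMb]
    rw [← Finset.sum_div, Finset.sum_comm]
    exact havg _ _ fun j => hMc ε _ v
  have htot : ∀ ε, ∑ u, ∑ v, Mb ε u v = (∑ j ∈ J, ∑ u, ∑ v, M ε (j / 4) u v) / 81 := fun ε => by
    simp only [hMb, ← Finset.sum_div]
    congr 1
    rw [Finset.sum_comm (s := J)]
    exact Finset.sum_congr rfl fun u _ => Finset.sum_comm
  set ind : (Fin N → Bool) → V × V → ℝ := fun ε q =>
    if 1 ≤ sqDist y q.1 q.2 → (1 / 2 ≤ |radSum (y q.1) ε - radSum (y q.2) ε| ∧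
      |radSum (y q.1) ε| ≤ 10 ∧ |radSum (y q.2) ε| ≤ 10) then 1 else 0 with hind
  have hindE : ∀ q, 1 / 10 ≤ 𝔼 ε, ind ε q := fun q => by
    by_cases h : 1 ≤ sqDist y q.1 q.2
    · simp only [hind, h, true_imp_iff]
      exact one_tenth_le_expect_spread _ _ (hy _) (hy _) h
    · simp only [hind, h, false_imp_iff, if_true, Fintype.expect_const]
      norm_num
  have hgrid : ∀ ε q, ind ε q ≤ ∑ j ∈ J, splitInd y
      (Finset.univ.filter fun v => (j : ℝ) / 4 + 1 / 4 ≤ radSum (y v) ε)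
      (Finset.univ.filter fun u => radSum (y u) ε ≤ (j : ℝ) / 4) q := by
    intro ε q
    have h0 : ∀ j : ℤ, 0 ≤ splitInd y
      (Finset.univ.filter fun v => (j : ℝ) / 4 + 1 / 4 ≤ radSum (y v) ε)
      (Finset.univ.filter fun u => radSum (y u) ε ≤ (j : ℝ) / 4) q := fun j => by
      simp only [splitInd]; split_ifs <;> norm_num
    by_cases hq : 1 ≤ sqDist y q.1 q.2 → (1 / 2 ≤ |radSum (y q.1) ε - radSum (y q.2) ε| ∧
      |radSum (y q.1) ε| ≤ 10 ∧ |radSum (y q.2) ε| ≤ 10)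
    swap
    · simp only [hind, hq, if_false]
      exact Finset.sum_nonneg fun j _ => h0 j
    have hex : ∃ j ∈ J, (1 ≤ sqDist y q.1 q.2 → Splits
        (Finset.univ.filter fun v => (j : ℝ) / 4 + 1 / 4 ≤ radSum (y v) ε)
        (Finset.univ.filter fun u => radSum (y u) ε ≤ (j : ℝ) / 4) q.1 q.2) := by
      by_cases hf : 1 ≤ sqDist y q.1 q.2
      · obtain ⟨h1, h2, h3⟩ := hq hf
        rcases le_abs.1 h1 with h1 | h1
        · obtain ⟨j, hj, a, b⟩ := exists_grid_threshold h1 h3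
          exact ⟨j, hj, fun _ => Or.inl (by
            simpa only [Finset.mem_filter, Finset.mem_univ, true_and] using ⟨b, a⟩)⟩
        · rw [neg_sub] at h1
          obtain ⟨j, hj, a, b⟩ := exists_grid_threshold h1 h2
          exact ⟨j, hj, fun _ => Or.inr (by
            simpa only [Finset.mem_filter, Finset.mem_univ, true_and] using ⟨b, a⟩)⟩
      · exact ⟨0, by simp [hJ], fun h => (hf h).elim⟩
    obtain ⟨j, hj, hs⟩ := hex
    refine le_trans ?_ (Finset.single_le_sum (fun j _ => h0 j) hj)
    simp only [hind, splitInd]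
    rw [if_pos hq, if_pos hs]
  have hlow : ∀ ε, (∑ q, w q * ind ε q) / 81 - 1 / 1620 ≤ 4 * ∑ u, ∑ v, Mb ε u v := fun ε => by
    have h1 := Finset.sum_le_sum (s := J) fun j _ => hMw ε ((j : ℝ) / 4)
    rw [Finset.sum_sub_distrib, Finset.sum_const, nsmul_eq_mul, hJc, ← Finset.mul_sum,
      Finset.sum_comm] at h1
    have h2 : ∑ q, w q * ind ε q ≤ ∑ q, ∑ j ∈ J, w q * splitInd y
      (Finset.univ.filter fun v => (j : ℝ) / 4 + 1 / 4 ≤ radSum (y v) ε)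
      (Finset.univ.filter fun u => radSum (y u) ε ≤ (j : ℝ) / 4) q :=
      Finset.sum_le_sum fun q _ => by
        rw [← Finset.mul_sum]
        exact mul_le_mul_of_nonneg_left (hgrid ε q) (hw.1 q)
    rw [htot]
    linarith
  have hlowE : 1 / 6480 ≤ 𝔼 ε, ∑ u, ∑ v, Mb ε u v := by
    have h := Finset.expect_le_expect (s := Finset.univ) fun ε _ => hlow ε
    simp only [Finset.expect_sub_distrib, ← Finset.mul_expect, Fintype.expect_const,
      ← Finset.expect_div] at h
    rw [Finset.expect_sum_comm] at h
    simp only [← Finset.mul_expect] at h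
    have h2 : 1 / 10 ≤ ∑ q, w q * 𝔼 ε, ind ε q := by
      calc (1 / 10 : ℝ) = ∑ q, w q * (1 / 10) := by rw [← Finset.sum_mul, hw.2, one_mul]
        _ ≤ _ := Finset.sum_le_sum fun q _ => mul_le_mul_of_nonneg_left (hindE q) (hw.1 q)
    linarith
  refine chaining_contradiction htri hμd (δ := sepRadius L) (σ := 1 / 4) (P := 1 / 6480)
    (c := 1 / 51840) (L := L) (M := fun ε u v => (Mb ε u v + Mb (fun i => !ε i) v u) / 2)
    (fun ε u v => div_nonneg (add_nonneg (hMb0 _ _ _) (hMb0 _ _ _)) (by norm_num))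
    (fun ε u v => by simp only [Bool.not_not]; rw [add_comm]) (fun ε u => ?_) (fun ε u v h => ?_)
    (by norm_num) ?_ (by norm_num) (by norm_num) hL1 hL rfl
  · rw [← Finset.sum_div, Finset.sum_add_distrib]
    linarith [hMbr ε u, hMbc (fun i => !ε i) u]
  · by_cases h1 : Mb ε u v = 0
    · have h2 : Mb (fun i => !ε i) v u ≠ 0 := fun h2 => h (by rw [h1, h2]; simp)
      obtain ⟨h3, h4⟩ := hMbs _ _ _ h2
      rw [radSum_not, radSum_not] at h4
      exact ⟨by rwa [sqDist_comm], by linarith⟩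
    · exact hMbs _ _ _ h1
  · have e : 𝔼 ε, ∑ u, ∑ v, (Mb ε u v + Mb (fun i => !ε i) v u) / 2 =
        (𝔼 ε, ∑ u, ∑ v, Mb ε u v + 𝔼 ε : Fin N → Bool, ∑ u, ∑ v, Mb (fun i => !ε i) u v) / 2 := by
      rw [← Finset.expect_add_distrib, Finset.expect_div]
      refine Finset.expect_congr rfl fun ε _ => ?_
      rw [Finset.sum_comm (f := fun u v => Mb (fun i => !ε i) u v)]
      simp only [← Finset.sum_div, Finset.sum_add_distrib]
    rw [e, expect_cube_not fun ε => ∑ u, ∑ v, Mb ε u v]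
    linarith

/-! ### Finite distributions -/

theorem Pr_nonneg {Ω : Type*} [Fintype Ω] {μ : Ω → ℝ} (hμ : IsProbDist μ) (P : Ω → Prop) :
    0 ≤ Pr μ P :=
  Finset.sum_nonneg fun ω _ => by split_ifs; exacts [hμ.1 ω, le_rfl]

theorem Pr_mono {Ω : Type*} [Fintype Ω] {μ : Ω → ℝ} (hμ : IsProbDist μ) {P Q : Ω → Prop}
    (h : ∀ ω, P ω → Q ω) : Pr μ P ≤ Pr μ Q :=
  Finset.sum_le_sum fun ω _ => by
    by_cases hP : P ω
    · simp [hP, h ω hP]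
    · simp only [hP, if_false]; split_ifs; exacts [hμ.1 ω, le_rfl]

theorem Pr_le_one {Ω : Type*} [Fintype Ω] {μ : Ω → ℝ} (hμ : IsProbDist μ) (P : Ω → Prop) :
    Pr μ P ≤ 1 := by
  rw [← hμ.2]
  exact Finset.sum_le_sum fun ω _ => by split_ifs; exacts [le_rfl, hμ.1 ω]

theorem Pr_or_le {Ω : Type*} [Fintype Ω] {μ : Ω → ℝ} (hμ : IsProbDist μ) (P Q : Ω → Prop) :
    Pr μ (fun ω => P ω ∨ Q ω) ≤ Pr μ P + Pr μ Q := by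
  unfold Pr
  rw [← Finset.sum_add_distrib]
  refine Finset.sum_le_sum fun ω _ => ?_
  have := hμ.1 ω
  by_cases hP : P ω <;> by_cases hQ : Q ω <;> simp [hP, hQ, this]

theorem Pr_not {Ω : Type*} [Fintype Ω] {μ : Ω → ℝ} (hμ : IsProbDist μ) (P : Ω → Prop) :
    Pr μ (fun ω => ¬ P ω) = 1 - Pr μ P := by
  rw [eq_sub_iff_add_eq, ← hμ.2]
  unfold Pr
  rw [← Finset.sum_add_distrib]
  exact Finset.sum_congr rfl fun ω _ => by by_cases hP : P ω <;> simp [hP]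

theorem Pr_eq_zero {Ω : Type*} [Fintype Ω] (μ : Ω → ℝ) {P : Ω → Prop} (h : ∀ ω, ¬ P ω) :
    Pr μ P = 0 :=
  Finset.sum_eq_zero fun ω _ => if_neg (h ω)

/-- The joint distribution of a point and a conditional sample. -/
def condDist {Ω Ω' : Type*} (μ : Ω → ℝ) (ν : Ω → Ω' → ℝ) (q : Ω × Ω') : ℝ := μ q.1 * ν q.1 q.2

theorem Pr_condDist {Ω Ω' : Type*} [Fintype Ω] [Fintype Ω'] (μ : Ω → ℝ) (ν : Ω → Ω' → ℝ)
    (P : Ω × Ω' → Prop) : Pr (condDist μ ν) P = ∑ ω, μ ω * Pr (ν ω) fun ω' => P (ω, ω') := by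
  unfold Pr condDist
  rw [Fintype.sum_prod_type]
  refine Finset.sum_congr rfl fun ω _ => ?_
  rw [Finset.mul_sum]
  exact Finset.sum_congr rfl fun ω' _ => by simp only [mul_ite, mul_zero]

theorem IsProbDist.condDist {Ω Ω' : Type*} [Fintype Ω] [Fintype Ω'] {μ : Ω → ℝ} {ν : Ω → Ω' → ℝ}
    (hμ : IsProbDist μ) (hν : ∀ ω, IsProbDist (ν ω)) : IsProbDist (condDist μ ν) := by
  refine ⟨fun q => mul_nonneg (hμ.1 _) ((hν _).1 _), ?_⟩
  rw [Fintype.sum_prod_type]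
  simp only [_root_.condDist, ← Finset.mul_sum, (hν _).2, mul_one, hμ.2]

theorem Pr_condDist_le {Ω Ω' : Type*} [Fintype Ω] [Fintype Ω'] {μ : Ω → ℝ} (hμ : IsProbDist μ)
    (ν : Ω → Ω' → ℝ) {P : Ω × Ω' → Prop} {c : ℝ} (h : ∀ ω, Pr (ν ω) (fun ω' => P (ω, ω')) ≤ c) :
    Pr (condDist μ ν) P ≤ c := by
  rw [Pr_condDist]
  calc _ ≤ ∑ ω, μ ω * c := Finset.sum_le_sum fun ω _ => mul_le_mul_of_nonneg_left (h ω) (hμ.1 ω)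
    _ = c := by rw [← Finset.sum_mul, hμ.2, one_mul]

theorem Pr_prod {Ω Ω' : Type*} [Fintype Ω] [Fintype Ω'] (μ : Ω → ℝ) (ν : Ω' → ℝ)
    (P : Ω → Prop) (Q : Ω' → Prop) :
    Pr (condDist μ fun _ => ν) (fun q => P q.1 ∧ Q q.2) = Pr μ P * Pr ν Q := by
  rw [Pr_condDist]
  conv_rhs => rw [Pr, Finset.sum_mul]
  refine Finset.sum_congr rfl fun ω _ => ?_
  by_cases hP : P ω <;> simp [hP, Pr]

theorem Pr_prod_fst {Ω Ω' : Type*} [Fintype Ω] [Fintype Ω'] (μ : Ω → ℝ) {ν : Ω' → ℝ}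
    (hν : IsProbDist ν) (P : Ω → Prop) : Pr (condDist μ fun _ => ν) (fun q => P q.1) = Pr μ P := by
  have h := Pr_prod μ ν P fun _ => True
  simp only [and_true] at h
  rw [h, show Pr ν (fun _ => True) = 1 by simpa [Pr] using hν.2, mul_one]

theorem Pr_prod_snd {Ω Ω' : Type*} [Fintype Ω] [Fintype Ω'] {μ : Ω → ℝ} {ν : Ω' → ℝ}
    (hμ : IsProbDist μ) (Q : Ω' → Prop) :
    Pr (condDist μ fun _ => ν) (fun q => Q q.2) = Pr ν Q := by
  have h := Pr_prod μ ν (fun _ => True) Q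
  simp only [true_and] at h
  rw [h, show Pr μ (fun _ => True) = 1 by simpa [Pr] using hμ.2, one_mul]

/-- The law of a random variable with values in a finite type. -/
def lawOf {Ω S : Type*} [Fintype Ω] (μ : Ω → ℝ) (X : Ω → S) (s : S) : ℝ := Pr μ fun ω => X ω = s

theorem Pr_lawOf {Ω S : Type*} [Fintype Ω] [Fintype S] (μ : Ω → ℝ) (X : Ω → S) (P : S → Prop) :
    Pr (lawOf μ X) P = Pr μ fun ω => P (X ω) := by
  have : ∀ s, (if P s then lawOf μ X s else 0) =
      ∑ ω, if X ω = s then (if P (X ω) then μ ω else 0) else 0 := fun s => by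
    by_cases h : P s
    · simp only [h, if_true, lawOf, Pr]
      refine Finset.sum_congr rfl fun ω _ => ?_
      by_cases h' : X ω = s
      · subst h'; simp [h]
      · simp [h']
    · simp only [h, if_false]
      refine (Finset.sum_eq_zero fun ω _ => ?_).symm
      by_cases h' : X ω = s
      · subst h'; simp [h]
      · simp [h']
  unfold Pr
  simp only [this]
  rw [Finset.sum_comm]
  simp

theorem IsProbDist.lawOf {Ω S : Type*} [Fintype Ω] [Fintype S] {μ : Ω → ℝ} (hμ : IsProbDist μ)
    (X : Ω → S) : IsProbDist (lawOf μ X) := by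
  refine ⟨fun s => Pr_nonneg hμ _, ?_⟩
  have := Pr_lawOf μ X fun _ => True
  simp only [Pr, if_true] at this
  rw [this, hμ.2]

/-! ### Random threshold sets -/

/-- The random superlevel set of a `[0, 1]`-valued function at a uniform random level. -/
theorem exists_threshold_dist {V : Type*} [Fintype V] (f : V → ℝ) (h0 : ∀ u, 0 ≤ f u)
    (h1 : ∀ u, f u ≤ 1) :
    ∃ w : Finset V → ℝ, IsProbDist w ∧ (∀ u, Pr w (fun T => u ∈ T) = f u) ∧
      (∀ u v, Pr w (fun T => u ∈ T ∧ v ∈ T) = min (f u) (f v)) ∧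
      ∀ (e : Finset V) (a b : ℝ), 0 ≤ a → a ≤ b → b ≤ 1 → (∀ u ∈ e, a ≤ f u ∧ f u ≤ b) →
        Pr w (fun T => ∃ u ∈ e, ∃ v ∈ e, u ∈ T ∧ v ∉ T) ≤ b - a := by
  let X : ℝ → Finset V := fun r => Finset.univ.filter fun u => r ≤ f u
  let ν : MeasureTheory.Measure ℝ := MeasureTheory.volume.restrict (Set.Ioc 0 1)
  have hm : ∀ P : Finset V → Prop, MeasurableSet {r | P (X r)} := fun P => by
    have hset : {r | P (X r)} = ⋃ T ∈ Finset.univ.filter P, {r | X r = T} := by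
      ext r; simp
    rw [hset]
    refine Finset.measurableSet_biUnion _ fun T _ => ?_
    have : {r | X r = T} = ⋂ u, {r | r ≤ f u ↔ u ∈ T} := by
      ext r; simp [X, Finset.ext_iff]
    rw [this]
    refine MeasurableSet.iInter fun u => ?_
    by_cases hu : u ∈ T
    · simp only [hu, iff_true]
      exact (measurableSet_Iic : MeasurableSet (Set.Iic (f u)))
    · simp only [hu, iff_false, not_le]
      exact (measurableSet_Ioi : MeasurableSet (Set.Ioi (f u)))
  have hfin : ∀ s, ν s ≠ ⊤ := fun s => MeasureTheory.measure_ne_top _ _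
  let w : Finset V → ℝ := fun T => ν.real {r | X r = T}
  have hPr : ∀ P : Finset V → Prop, Pr w P = ν.real {r | P (X r)} := fun P => by
    have hset : {r | P (X r)} = ⋃ T ∈ Finset.univ.filter P, {r | X r = T} := by
      ext r; simp
    rw [hset, MeasureTheory.measureReal_biUnion_finset]
    · rw [Pr, Finset.sum_filter]
    · intro T _ T' _ hne
      exact Set.disjoint_left.2 fun r h h' => hne (h.symm.trans h')
    · exact fun T _ => hm fun S => S = T
  have hIoc : ∀ a b : ℝ, 0 ≤ a → a ≤ b → b ≤ 1 → ν.real (Set.Ioc a b) = b - a := by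
    intro a b ha hab hb
    rw [MeasureTheory.measureReal_restrict_apply measurableSet_Ioc, Set.inter_eq_left.2
      (Set.Ioc_subset_Ioc ha hb), Real.volume_real_Ioc_of_le hab]
  have hIic : ∀ c : ℝ, 0 ≤ c → c ≤ 1 → ν.real (Set.Iic c) = c := by
    intro c hc hc1
    rw [MeasureTheory.measureReal_restrict_apply measurableSet_Iic]
    have : Set.Iic c ∩ Set.Ioc 0 1 = Set.Ioc 0 c := by
      ext r; simp only [Set.mem_inter_iff, Set.mem_Iic, Set.mem_Ioc]
      constructor
      · rintro ⟨a, b, d⟩; exact ⟨b, a⟩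
      · rintro ⟨a, b⟩; exact ⟨b, a, b.trans hc1⟩
    rw [this, Real.volume_real_Ioc_of_le hc, sub_zero]
  refine ⟨w, ⟨fun T => MeasureTheory.measureReal_nonneg, ?_⟩, fun u => ?_, fun u v => ?_, ?_⟩
  · have h := hPr fun _ => True
    simp only [Pr, if_true] at h
    rw [h]
    simp [ν, MeasureTheory.measureReal_def]
  · rw [hPr]
    simpa [X, Set.Iic] using hIic _ (h0 u) (h1 u)
  · rw [hPr]
    have := hIic (min (f u) (f v)) (le_min (h0 u) (h0 v)) ((min_le_left _ _).trans (h1 u))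
    simpa [X, Set.Iic] using this
  · intro e a b ha hab hb he
    rw [hPr, ← hIoc a b ha hab hb]
    refine MeasureTheory.measureReal_mono ?_ (hfin _)
    rintro r ⟨u, hu, v, hv, h3, h4⟩
    simp only [X, Finset.mem_filter, Finset.mem_univ, true_and, not_le] at h3 h4
    exact ⟨(he v hv).1.trans_lt h4, h3.trans (he u hu).2⟩

/-- A Bernoulli random subset. -/
theorem exists_bernoulli_dist (V : Type*) [Fintype V] {α : ℝ} (h0 : 0 ≤ α) (h1 : α ≤ 1) :
    ∃ w : Finset V → ℝ, IsProbDist w ∧ ∀ C : Finset V, Pr w (fun T => C ⊆ T) = α ^ C.card := by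
  let w : Finset V → ℝ := fun T => (∏ _i ∈ T, α) * ∏ _i ∈ Finset.univ \ T, (1 - α)
  have hC : ∀ C : Finset V, Pr w (fun T => C ⊆ T) = α ^ C.card := fun C => by
    have h := Finset.prod_add (fun _ : V => α) (fun i => if i ∈ C then 0 else 1 - α) Finset.univ
    have hl : ∏ i : V, (α + if i ∈ C then 0 else 1 - α) = α ^ C.card := by
      have : ∀ i : V, (α + if i ∈ C then 0 else 1 - α) = if i ∈ C then α else 1 := fun i => by
        split_ifs <;> ring
      simp only [this, Finset.prod_ite_mem, Finset.univ_inter, Finset.prod_const]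
    rw [← hl, h, Finset.powerset_univ]
    refine Finset.sum_congr rfl fun T _ => ?_
    by_cases hCT : C ⊆ T
    · rw [if_pos hCT]
      refine congrArg₂ _ rfl (Finset.prod_congr rfl fun i hi => ?_)
      rw [if_neg fun hi' => (Finset.mem_sdiff.1 hi).2 (hCT hi')]
    · rw [if_neg hCT]
      obtain ⟨i, hi, hiT⟩ := Finset.not_subset.1 hCT
      have h0 : ∏ i ∈ Finset.univ \ T, (if i ∈ C then 0 else 1 - α) = 0 :=
        Finset.prod_eq_zero (i := i) (by simp [hiT]) (by simp [hi])
      rw [h0, mul_zero]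
  refine ⟨w, ⟨fun T => mul_nonneg (Finset.prod_nonneg fun _ _ => h0)
    (Finset.prod_nonneg fun _ _ => by linarith), ?_⟩, hC⟩
  simpa [Pr] using hC ∅

/-- A random set of labels whose members are uniformly likely and almost pairwise exclusive. -/
theorem exists_label_dist (V : Type*) [Fintype V] [Nonempty V] {m : ℝ} (hm : 1 ≤ m) :
    ∃ (α : ℝ) (w : Finset V → ℝ), 1 / (Fintype.card V : ℝ) ≤ α ∧ 1 / m ≤ α ∧ IsProbDist w ∧
      (∀ c, Pr w (fun T => c ∈ T) = α) ∧
      ∀ c c', c ≠ c' → Pr w (fun T => c ∈ T ∧ c' ∈ T) ≤ α / m := by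
  have hn : (0 : ℝ) < Fintype.card V := by exact_mod_cast Fintype.card_pos
  rcases le_total m (Fintype.card V) with h | h
  · obtain ⟨w, hw, hC⟩ := exists_bernoulli_dist V (α := 1 / m) (by positivity)
      (by rw [div_le_one (by linarith)]; exact hm)
    refine ⟨1 / m, w, one_div_le_one_div_of_le (by linarith) h, le_rfl, hw, fun c => ?_,
      fun c c' hne => ?_⟩
    · simpa using hC {c}
    · have := hC {c, c'}
      simp only [Finset.insert_subset_iff, Finset.singleton_subset_iff, Finset.card_pair hne]
        at this
      rw [this, sq, mul_one_div]
  · have hu : IsProbDist fun _ : V => 1 / (Fintype.card V : ℝ) :=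
      ⟨fun _ => by positivity, by simp [hn.ne']⟩
    refine ⟨1 / Fintype.card V, lawOf (fun _ : V => 1 / (Fintype.card V : ℝ)) fun v => {v}, le_rfl,
      one_div_le_one_div_of_le hn h, hu.lawOf _, fun c => ?_, fun c c' hne => ?_⟩
    · rw [Pr_lawOf]
      simp [Pr]
    · rw [Pr_lawOf, Pr_eq_zero]
      · positivity
      · rintro v ⟨h1, h2⟩
        exact hne ((Finset.mem_singleton.1 h1).trans (Finset.mem_singleton.1 h2).symm)

/-! ### Random partitions -/

/-- A random partition separating points at distance at least one with probability at least `1 - q`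
and separating a set of diameter `D` with probability at most `K * D`. -/
def HasPartition {V : Type} (d : V → V → ℝ) (q K : ℝ) : Prop :=
  ∃ (Ω : Type) (_ : Fintype Ω) (w : Ω → ℝ) (g : Ω → V → ℕ), IsProbDist w ∧
    (∀ u v, 1 ≤ d u v → Pr w (fun ω => g ω u = g ω v) ≤ q) ∧
    ∀ (e : Finset V) (D : ℝ), 0 ≤ D → (∀ u ∈ e, ∀ v ∈ e, d u v ≤ D) →
      Pr w (fun ω => ∃ u ∈ e, ∃ v ∈ e, g ω u ≠ g ω v) ≤ K * D

theorem HasPartition.mul {V : Type} {d : V → V → ℝ} {q q' K K' : ℝ} (hq : 0 ≤ q)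
    (h : HasPartition d q K) (h' : HasPartition d q' K') : HasPartition d (q * q') (K + K') := by
  obtain ⟨Ω, _, w, g, hw, hg, hK⟩ := h
  obtain ⟨Ω', _, w', g', hw', hg', hK'⟩ := h'
  refine ⟨Ω × Ω', inferInstance, condDist w fun _ => w', fun p u => Nat.pair (g p.1 u) (g' p.2 u),
    hw.condDist fun _ => hw', fun u v huv => ?_, fun e D hD he => ?_⟩
  · simp only [Nat.pair_eq_pair]
    rw [Pr_prod w w' (fun ω => g ω u = g ω v) fun ω => g' ω u = g' ω v]
    exact mul_le_mul (hg u v huv) (hg' u v huv) (Pr_nonneg hw' _) hq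
  · refine (Pr_mono (hw.condDist fun _ => hw') (Q := fun p => (∃ u ∈ e, ∃ v ∈ e, g p.1 u ≠ g p.1 v) ∨
      ∃ u ∈ e, ∃ v ∈ e, g' p.2 u ≠ g' p.2 v) ?_).trans ((Pr_or_le (hw.condDist fun _ => hw') _ _).trans ?_)
    · rintro p ⟨u, hu, v, hv, hne⟩
      rw [Ne, Nat.pair_eq_pair, not_and_or] at hne
      exact hne.imp (fun h => ⟨u, hu, v, hv, h⟩) fun h => ⟨u, hu, v, hv, h⟩
    · rw [Pr_prod_fst w hw' fun ω => ∃ u ∈ e, ∃ v ∈ e, g ω u ≠ g ω v,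
        Pr_prod_snd hw fun ω => ∃ u ∈ e, ∃ v ∈ e, g' ω u ≠ g' ω v, add_mul]
      exact add_le_add (hK e D hD he) (hK' e D hD he)

theorem HasPartition.pow {V : Type} {d : V → V → ℝ} {q K : ℝ} (hq : 0 ≤ q)
    (h : HasPartition d q K) (l : ℕ) : HasPartition d (q ^ l) (l * K) := by
  induction l with
  | zero =>
    refine ⟨Unit, inferInstance, fun _ => 1, fun _ _ => 0, ⟨fun _ => zero_le_one, by simp⟩,
      fun u v _ => by simp [Pr], fun e D hD _ => by simp [Pr]⟩
  | succ l ih =>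
    have := HasPartition.mul (pow_nonneg hq l) ih h
    rw [pow_succ]
    push_cast
    rwa [add_mul, one_mul]

/-- A Lipschitz function vanishing on `A` and equal to one at distance `δ` from `A`. -/
theorem exists_bump {V : Type*} {d : V → V → ℝ} (hd0 : ∀ u v, 0 ≤ d u v) (hself : ∀ u, d u u = 0)
    (hsymm : ∀ u v, d u v = d v u) (htri : ∀ u v w, d u w ≤ d u v + d v w) {δ : ℝ} (hδ : 0 < δ)
    (A : Finset V) :
    ∃ f : V → ℝ, (∀ u, 0 ≤ f u ∧ f u ≤ 1) ∧ (∀ a ∈ A, f a = 0) ∧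
      (∀ u, (∀ a ∈ A, δ ≤ d a u) → f u = 1) ∧ ∀ u v, f u - f v ≤ d u v / δ := by
  induction A using Finset.induction_on with
  | empty =>
    refine ⟨fun _ => 1, fun _ => ⟨zero_le_one, le_rfl⟩, by simp, fun _ _ => rfl, fun u v => ?_⟩
    rw [sub_self]
    exact div_nonneg (hd0 u v) hδ.le
  | insert a A _ ih =>
    obtain ⟨f, h01, hA, h1, hL⟩ := ih
    have hpos : ∀ u, 0 ≤ d a u / δ := fun u => div_nonneg (hd0 a u) hδ.le
    refine ⟨fun u => min (f u) (d a u / δ), fun u => ⟨le_min (h01 u).1 (hpos u),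
      (min_le_left _ _).trans (h01 u).2⟩, fun b hb => ?_, fun u hu => ?_, fun u v => ?_⟩
    · rcases Finset.mem_insert.1 hb with rfl | hb
      · simp only [hself, zero_div]
        exact min_eq_right (h01 b).1
      · simp only [hA b hb]
        exact min_eq_left (hpos b)
    · simp only [h1 u fun b hb => hu b (Finset.mem_insert_of_mem hb)]
      refine min_eq_left ?_
      rw [le_div_iff₀ hδ, one_mul]
      exact hu a (Finset.mem_insert_self a A)
    · have h2 : d a u / δ ≤ d a v / δ + d u v / δ := by
        rw [← add_div, hsymm u v]
        exact div_le_div_of_nonneg_right (htri a v u) hδ.le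
      have h3 := hL u v
      simp only
      rcases min_choice (f v) (d a v / δ) with h | h <;> rw [h]
      · linarith [min_le_left (f u) (d a u / δ)]
      · linarith [min_le_right (f u) (d a u / δ)]

/-- The random partition obtained from a random pair of separated sets. -/
theorem hasPartition_sqDist {V : Type} [Fintype V] {N : ℕ} (y : V → Fin N → ℝ)
    (hy : ∀ u, ∑ i, y u i ^ 2 ≤ 1) (htri : ∀ u v w, sqDist y u w ≤ sqDist y u v + sqDist y v w)
    {L : ℝ} (hL1 : 1 ≤ L) (hL : Real.log (Fintype.card V) ≤ L) :
    HasPartition (sqDist y) (1 - 1 / 1620) (1 / sepRadius L) := by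
  have hδ : 0 < sepRadius L := by
    have : 0 < √L := Real.sqrt_pos.2 (by linarith)
    unfold sepRadius; positivity
  set δ := sepRadius L with hδdef
  let J := {p : Finset V × Finset V // ∀ a ∈ p.1, ∀ b ∈ p.2, δ < sqDist y a b}
  have : Nonempty J := ⟨⟨(∅, ∅), by simp⟩⟩
  obtain ⟨q, hq, hsplit⟩ := exists_mixed_strategy (I := V × V) (J := J)
    (fun p j => splitInd y j.1.1 j.1.2 p) (1 / 1620) fun w hw => by
      obtain ⟨A, B, hAB, h⟩ := exists_separated_pair y hy htri hL1 hL hw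
      exact ⟨⟨(A, B), hAB⟩, h⟩
  choose f h01 hfA hfB hfL using fun j : J => exists_bump (sqDist_nonneg y) (sqDist_self y)
    (sqDist_comm y) htri hδ j.1.1
  choose w hw hw1 _ hwc using fun j : J =>
    exists_threshold_dist (f j) (fun u => (h01 j u).1) fun u => (h01 j u).2
  refine ⟨J × Finset V, inferInstance, condDist q w, fun p u => if u ∈ p.2 then 1 else 0,
    hq.condDist hw, fun u v huv => ?_, fun e D hD he => ?_⟩
  · have hsep : ∀ j : J, ∀ a ∈ j.1.1, ∀ b ∈ j.1.2,
        Pr (w j) (fun T => (a ∈ T ↔ b ∈ T)) ≤ 0 := fun j a ha b hb => by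
      refine (Pr_mono (hw j) (Q := fun T => a ∈ T ∨ ¬ b ∈ T) fun T h => ?_).trans
        ((Pr_or_le (hw j) _ _).trans ?_)
      · by_cases h' : a ∈ T
        · exact Or.inl h'
        · exact Or.inr fun h'' => h' (h.2 h'')
      · rw [Pr_not (hw j), hw1, hw1, hfA j a ha, hfB j b fun a' ha' => (j.2 a' ha' b hb).le]
        norm_num
    have hj : ∀ j : J, Pr (w j) (fun T => (if u ∈ T then 1 else 0 : ℕ) = if v ∈ T then 1 else 0) ≤
        1 - splitInd y j.1.1 j.1.2 (u, v) := fun j => by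
      have hiff : (fun T : Finset V => (if u ∈ T then 1 else 0 : ℕ) = if v ∈ T then 1 else 0) =
          fun T => (u ∈ T ↔ v ∈ T) := by
        funext T
        by_cases h1 : u ∈ T <;> by_cases h2 : v ∈ T <;> simp [h1, h2]
      rw [hiff]
      by_cases hs : Splits j.1.1 j.1.2 u v
      · have : splitInd y j.1.1 j.1.2 (u, v) = 1 := if_pos fun _ => hs
        rw [this, sub_self]
        rcases hs with ⟨h1, h2⟩ | ⟨h1, h2⟩
        · exact hsep j u h1 v h2
        · simpa only [iff_comm] using hsep j v h1 u h2
      · have : splitInd y j.1.1 j.1.2 (u, v) = 0 := if_neg fun h => hs (h huv)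
        rw [this, sub_zero]
        exact Pr_le_one (hw j) _
    rw [Pr_condDist]
    have h2 := Finset.sum_le_sum fun j (_ : j ∈ Finset.univ) =>
      mul_le_mul_of_nonneg_left (hj j) (hq.1 j)
    simp only [mul_sub, mul_one, Finset.sum_sub_distrib, hq.2] at h2
    have h3 := hsplit (u, v)
    exact h2.trans (by linarith)
  · refine Pr_condDist_le hq w fun j => ?_
    rcases e.eq_empty_or_nonempty with rfl | hne
    · rw [Pr_eq_zero _ (by simp)]
      positivity
    obtain ⟨a, ha, hmin⟩ := e.exists_min_image (f j) hne
    obtain ⟨b, hb, hmax⟩ := e.exists_max_image (f j) hne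
    have h1 := hwc j e (f j a) (f j b) (h01 j a).1 (hmin b hb) (h01 j b).2
      fun u hu => ⟨hmin u hu, hmax u hu⟩
    refine (Pr_mono (hw j) ?_).trans (h1.trans ((hfL j b a).trans ?_))
    · rintro T ⟨u, hu, v, hv, hne⟩
      by_cases h1 : u ∈ T <;> by_cases h2 : v ∈ T
      · simp [h1, h2] at hne
      · exact ⟨u, hu, v, hv, h1, h2⟩
      · exact ⟨v, hv, u, hu, h2, h1⟩
      · simp [h1, h2] at hne
    · rw [one_div_mul_eq_div]
      exact div_le_div_of_nonneg_right (he b hb a ha) hδ.le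

/-! ### The kernel embedding -/

theorem posSemidef_of_quadForm {V : Type*} [Fintype V] {B : Matrix V V ℝ}
    (hsymm : ∀ u v, B u v = B v u) (h : ∀ z : V → ℝ, 0 ≤ ∑ u, ∑ v, z u * (B u v * z v)) :
    B.PosSemidef := by
  refine Matrix.PosSemidef.of_dotProduct_mulVec_nonneg (Matrix.IsHermitian.ext fun u v => ?_)
    fun z => ?_
  · simp [hsymm u v]
  · simpa [dotProduct, Matrix.mulVec, Finset.mul_sum] using h z

theorem Matrix.PosSemidef.quadForm_nonneg {V : Type*} [Fintype V] {B : Matrix V V ℝ}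
    (hB : B.PosSemidef) (z : V → ℝ) : 0 ≤ ∑ u, ∑ v, z u * (B u v * z v) := by
  simpa [dotProduct, Matrix.mulVec, Finset.mul_sum] using hB.dotProduct_mulVec_nonneg z

theorem Matrix.PosSemidef.symm_apply {V : Type*} {B : Matrix V V ℝ} (hB : B.PosSemidef) (u v : V) :
    B u v = B v u := by
  simpa using hB.isHermitian.apply v u

theorem posSemidef_entrywise_pow {V : Type*} [Fintype V] {B : Matrix V V ℝ} (hB : B.PosSemidef)
    (k : ℕ) : (Matrix.of fun u v => B u v ^ k).PosSemidef := by
  induction k with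
  | zero =>
    refine posSemidef_of_quadForm (fun _ _ => by simp) fun z => ?_
    have : ∑ u, ∑ v, z u * ((Matrix.of fun u v => B u v ^ 0) u v * z v) = (∑ u, z u) ^ 2 := by
      simp [sq, Finset.sum_mul_sum]
    rw [this]
    exact sq_nonneg _
  | succ k ih =>
    have e : (Matrix.of fun u v => B u v ^ (k + 1)) =
        (Matrix.of fun u v => B u v ^ k).hadamard B := by
      ext u v
      simp [pow_succ]
    rw [e]
    exact ih.hadamard hB

theorem posSemidef_entrywise_exp {V : Type*} [Fintype V] {B : Matrix V V ℝ} (hB : B.PosSemidef) :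
    (Matrix.of fun u v => Real.exp (B u v)).PosSemidef := by
  refine posSemidef_of_quadForm (fun u v => by simp [hB.symm_apply u v]) fun z => ?_
  have hexp : ∀ t : ℝ, HasSum (fun k : ℕ => t ^ k / k.factorial) (Real.exp t) := fun t => by
    rw [Real.exp_eq_exp_ℝ]
    exact NormedSpace.expSeries_div_hasSum_exp t
  have hsum : HasSum (fun k : ℕ => ∑ u, ∑ v, z u * (B u v ^ k / k.factorial * z v))
      (∑ u, ∑ v, z u * (Real.exp (B u v) * z v)) :=
    hasSum_sum fun u _ => hasSum_sum fun v _ => ((hexp _).mul_right _).mul_left _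
  refine hsum.nonneg fun k => ?_
  have h := (posSemidef_entrywise_pow hB k).quadForm_nonneg z
  have e : ∑ u, ∑ v, z u * (B u v ^ k / k.factorial * z v) =
      (∑ u, ∑ v, z u * ((Matrix.of fun u v => B u v ^ k) u v * z v)) / k.factorial := by
    simp only [Finset.sum_div, Matrix.of_apply]
    exact Finset.sum_congr rfl fun u _ => Finset.sum_congr rfl fun v _ => by ring
  rw [e]
  positivity

theorem posSemidef_min {V : Type*} [Fintype V] (f : V → ℝ) (hf : ∀ u, 0 ≤ f u) :
    (Matrix.of fun u v => min (f u) (f v)).PosSemidef := by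
  refine posSemidef_of_quadForm (fun u v => min_comm _ _) fun z => ?_
  set R := 1 + ∑ u, f u with hR
  have hR0 : 0 < R := by
    have := Finset.sum_nonneg fun u (_ : u ∈ Finset.univ) => hf u
    linarith
  obtain ⟨w, hw, -, hw2, -⟩ := exists_threshold_dist (fun u => f u / R)
    (fun u => div_nonneg (hf u) hR0.le) fun u => by
      rw [div_le_one hR0]
      have := Finset.single_le_sum (fun u _ => hf u) (Finset.mem_univ u)
      linarith
  have hmin : ∀ u v, min (f u) (f v) = ∑ T, R * w T * ((if u ∈ T then 1 else 0) *
      if v ∈ T then 1 else 0) := fun u v => by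
    have : min (f u) (f v) = R * min (f u / R) (f v / R) := by
      rw [mul_min_of_nonneg _ _ hR0.le, mul_div_cancel₀ _ hR0.ne', mul_div_cancel₀ _ hR0.ne']
    rw [this, ← hw2, Pr, Finset.mul_sum]
    refine Finset.sum_congr rfl fun T _ => ?_
    by_cases h1 : u ∈ T <;> by_cases h2 : v ∈ T <;> simp [h1, h2]
  have e : ∑ u, ∑ v, z u * ((Matrix.of fun u v => min (f u) (f v)) u v * z v) =
      ∑ T, R * w T * (∑ u, z u * if u ∈ T then 1 else 0) ^ 2 := by
    simp only [Matrix.of_apply, hmin, Finset.sum_mul, Finset.mul_sum, sq]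
    have : ∀ u, ∑ v, ∑ T, z u * (R * w T * ((if u ∈ T then 1 else 0) * if v ∈ T then 1 else 0) * z v)
        = ∑ T, ∑ v, z u * (R * w T * ((if u ∈ T then 1 else 0) * if v ∈ T then 1 else 0) * z v) :=
      fun u => Finset.sum_comm
    simp only [this]
    rw [Finset.sum_comm]
    refine Finset.sum_congr rfl fun T _ => ?_
    rw [Finset.sum_comm]
    exact Finset.sum_congr rfl fun u _ => Finset.sum_congr rfl fun v _ => by ring
  rw [e]
  exact Finset.sum_nonneg fun T _ => mul_nonneg (mul_nonneg hR0.le (hw.1 T)) (sq_nonneg _)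

theorem Matrix.PosSemidef.exists_vectors {V : Type*} [Fintype V] {B : Matrix V V ℝ}
    (hB : B.PosSemidef) : ∃ (N : ℕ) (y : V → Fin N → ℝ), ∀ u v, ∑ i, y u i * y v i = B u v := by
  open scoped MatrixOrder in
  obtain ⟨X, hX⟩ := CStarAlgebra.nonneg_iff_eq_star_mul_self.mp hB.nonneg
  refine ⟨Fintype.card V, fun u i => X ((Fintype.equivFin V).symm i) u, fun u v => ?_⟩
  rw [hX, Equiv.sum_comp (Fintype.equivFin V).symm fun i => X i u * X i v]
  simp [Matrix.mul_apply, Matrix.star_eq_conjTranspose]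

/-- The normalized distance of nonzero vectors. -/
def normDist {V H : Type*} [NormedAddCommGroup H] [InnerProductSpace ℝ H] (x : V → H) (u v : V) :
    ℝ := 1 - ⟪x u, x v⟫ / max (‖x u‖ ^ 2) (‖x v‖ ^ 2)

theorem normDist_comm {V H : Type*} [NormedAddCommGroup H] [InnerProductSpace ℝ H] (x : V → H)
    (u v : V) : normDist x u v = normDist x v u := by
  rw [normDist, normDist, real_inner_comm, max_comm]

theorem L22.inner_le_right {V H : Type*} [NormedAddCommGroup H] [InnerProductSpace ℝ H] {x : V → H}
    (hx : L22 x) (u v : V) : (⟪x u, x v⟫ : ℝ) ≤ ‖x v‖ ^ 2 := by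
  rw [real_inner_comm]
  exact (hx.2 v u).2

theorem L22.inner_add_inner_le {V H : Type*} [NormedAddCommGroup H] [InnerProductSpace ℝ H]
    {x : V → H} (hx : L22 x) (u v w : V) :
    (⟪x u, x v⟫ + ⟪x v, x w⟫ : ℝ) ≤ ‖x v‖ ^ 2 + ⟪x u, x w⟫ := by
  have h := hx.1 u v w
  simp only [norm_sub_sq_real] at h
  linarith

theorem normDist_nonneg {V H : Type*} [NormedAddCommGroup H] [InnerProductSpace ℝ H] {x : V → H}
    (hx : L22 x) (u v : V) : 0 ≤ normDist x u v := by
  have : ⟪x u, x v⟫ / max (‖x u‖ ^ 2) (‖x v‖ ^ 2) ≤ 1 :=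
    div_le_one_of_le₀ ((hx.2 u v).2.trans (le_max_left _ _)) (by positivity)
  unfold normDist
  linarith

theorem normDist_triangle {V H : Type*} [NormedAddCommGroup H] [InnerProductSpace ℝ H] {x : V → H}
    (hx : L22 x) (hne : ∀ u, x u ≠ 0) (u v w : V) :
    normDist x u w ≤ normDist x u v + normDist x v w := by
  have hpos : ∀ u, 0 < ‖x u‖ ^ 2 := fun u => by have := norm_pos_iff.2 (hne u); positivity
  have main : ∀ u v w, ‖x v‖ ^ 2 ≤ ‖x u‖ ^ 2 → ‖x w‖ ^ 2 ≤ ‖x u‖ ^ 2 →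
      normDist x u w ≤ normDist x u v + normDist x v w := fun u v w h1 h2 => by
    have h := hx.inner_add_inner_le u v w
    unfold normDist
    rw [max_eq_left h1, max_eq_left h2]
    set m := max (‖x v‖ ^ 2) (‖x w‖ ^ 2) with hm
    set a := ‖x u‖ ^ 2
    have hm0 : 0 < m := (hpos v).trans_le (le_max_left _ _)
    have ha : 0 < a := hpos u
    have hma : m ≤ a := max_le h1 h2
    have hq : (⟪x v, x w⟫ : ℝ) / m ≤ 1 := div_le_one_of_le₀ ((hx.2 v w).2.trans (le_max_left _ _)) hm0.le
    have h3 : (⟪x v, x w⟫ : ℝ) / m * (a - m) ≤ a - m :=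
      mul_le_of_le_one_left (by linarith) hq
    have h4 : (⟪x v, x w⟫ : ℝ) / m * m = ⟪x v, x w⟫ := div_mul_cancel₀ _ hm0.ne'
    have h5 : ‖x v‖ ^ 2 ≤ m := le_max_left _ _
    have h6 : (⟪x v, x w⟫ : ℝ) / m * a ≤ a + ⟪x u, x w⟫ - ⟪x u, x v⟫ := by nlinarith
    have h7 := (le_div_iff₀ ha).2 h6
    rw [sub_div, add_div, div_self ha.ne'] at h7
    linarith
  rcases le_total (‖x v‖ ^ 2) (‖x u‖ ^ 2) with h1 | h1
  · rcases le_total (‖x w‖ ^ 2) (‖x u‖ ^ 2) with h2 | h2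
    · exact main u v w h1 h2
    · rw [normDist_comm x u w, normDist_comm x u v, normDist_comm x v w, add_comm]
      exact main w v u (h1.trans h2) h2
  · rcases le_total (‖x w‖ ^ 2) (‖x v‖ ^ 2) with h2 | h2
    · have h := hx.inner_add_inner_le u v w
      have hb := hpos v
      have h3 : (⟪x u, x w⟫ : ℝ) / ‖x v‖ ^ 2 ≤ ⟪x u, x w⟫ / max (‖x u‖ ^ 2) (‖x w‖ ^ 2) :=
        div_le_div_of_nonneg_left (hx.2 u w).1 ((hpos u).trans_le (le_max_left _ _)) (max_le h1 h2)
      have h4 := div_le_div_of_nonneg_right h hb.le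
      rw [add_div, add_div, div_self hb.ne'] at h4
      unfold normDist
      rw [max_eq_right h1, max_eq_left h2]
      linarith
    · rw [normDist_comm x u w, normDist_comm x u v, normDist_comm x v w, add_comm]
      exact main w v u h2 (h1.trans h2)

theorem normSq_mul_normDist_le {V H : Type*} [NormedAddCommGroup H] [InnerProductSpace ℝ H]
    {x : V → H} (hx : L22 x) (hne : ∀ u, x u ≠ 0) (u v : V) :
    ‖x u‖ ^ 2 * normDist x u v ≤ ‖x u - x v‖ ^ 2 := by
  have hu : 0 < ‖x u‖ ^ 2 := by have := norm_pos_iff.2 (hne u); positivity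
  set M := max (‖x u‖ ^ 2) (‖x v‖ ^ 2) with hM
  have hM0 : 0 < M := hu.trans_le (le_max_left _ _)
  have h1 : M * normDist x u v = M - ⟪x u, x v⟫ := by
    unfold normDist; rw [← hM]; field_simp
  have h2 := mul_le_mul_of_nonneg_right (le_max_left (‖x u‖ ^ 2) (‖x v‖ ^ 2)) (normDist_nonneg hx u v)
  rw [← hM, h1] at h2
  refine h2.trans ?_
  rw [norm_sub_sq_real]
  have h3 := (hx.2 u v).2
  have h4 := hx.inner_le_right u v
  rcases max_choice (‖x u‖ ^ 2) (‖x v‖ ^ 2) with h | h <;> rw [hM, h] <;> linarith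

theorem le_normDist_of_far {V H : Type*} [NormedAddCommGroup H] [InnerProductSpace ℝ H] {x : V → H}
    (hne : ∀ u, x u ≠ 0) {β : ℝ} (hβ0 : 0 < β) (hβ1 : β < 1) {u v : V}
    (huv : β * min (‖x u‖ ^ 2) (‖x v‖ ^ 2) ≤ ‖x u - x v‖ ^ 2) : β / 4 ≤ normDist x u v := by
  have hu : 0 < ‖x u‖ ^ 2 := by have := norm_pos_iff.2 (hne u); positivity
  have hv : 0 < ‖x v‖ ^ 2 := by have := norm_pos_iff.2 (hne v); positivity
  rw [norm_sub_sq_real] at huv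
  have hsum := min_add_max (‖x u‖ ^ 2) (‖x v‖ ^ 2)
  have hle := min_le_max (a := ‖x u‖ ^ 2) (b := ‖x v‖ ^ 2)
  have hs0 : 0 < min (‖x u‖ ^ 2) (‖x v‖ ^ 2) := lt_min hu hv
  unfold normDist
  set M := max (‖x u‖ ^ 2) (‖x v‖ ^ 2)
  set s := min (‖x u‖ ^ 2) (‖x v‖ ^ 2)
  have hM0 : 0 < M := hs0.trans_le hle
  have h : (⟪x u, x v⟫ : ℝ) ≤ (1 - β / 4) * M := by
    rcases le_total (M / 2) s with h | h
    · nlinarith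
    · nlinarith
  have := (div_le_iff₀ hM0).2 h
  linarith

/-- The Gaussian-type kernel of the normalized distance is realized by unit vectors satisfying the
`ℓ₂²` triangle inequality, in which far pairs have constant distance. -/
theorem exists_kernel_embedding {V H : Type*} [Fintype V] [NormedAddCommGroup H]
    [InnerProductSpace ℝ H] {x : V → H} (hx : L22 x) (hne : ∀ u, x u ≠ 0) {β : ℝ} (hβ0 : 0 < β)
    (hβ1 : β < 1) :
    ∃ (N : ℕ) (y : V → Fin N → ℝ), (∀ u, ∑ i, y u i ^ 2 ≤ 1) ∧
      (∀ u v w, sqDist y u w ≤ sqDist y u v + sqDist y v w) ∧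
      (∀ u v, β * min (‖x u‖ ^ 2) (‖x v‖ ^ 2) ≤ ‖x u - x v‖ ^ 2 → 1 ≤ sqDist y u v) ∧
      ∀ u v, ‖x u‖ ^ 2 * sqDist y u v ≤ 8 / β * ‖x u - x v‖ ^ 2 := by
  have hpos : ∀ u, 0 < ‖x u‖ ^ 2 := fun u => by have := norm_pos_iff.2 (hne u); positivity
  set c := 4 / β with hc
  have hc0 : 0 < c := by positivity
  have hpsd : (Matrix.of fun u v => Real.exp (-c * normDist x u v)).PosSemidef := by
    have h1 := ((Matrix.posSemidef_gram ℝ x).hadamard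
      (posSemidef_min (fun u => (‖x u‖ ^ 2)⁻¹) fun u => (inv_pos.2 (hpos u)).le)).smul hc0.le
    have h2 := (posSemidef_entrywise_exp h1).smul (Real.exp_pos (-c)).le
    convert h2 using 1
    ext u v
    have hmin : min (‖x u‖ ^ 2)⁻¹ (‖x v‖ ^ 2)⁻¹ = (max (‖x u‖ ^ 2) (‖x v‖ ^ 2))⁻¹ := by
      rcases le_total (‖x u‖ ^ 2) (‖x v‖ ^ 2) with h | h
      · rw [max_eq_right h, min_eq_right (inv_anti₀ (hpos u) h)]
      · rw [max_eq_left h, min_eq_left (inv_anti₀ (hpos v) h)]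
    simp only [Matrix.smul_apply, Matrix.of_apply, Matrix.hadamard_apply, Matrix.gram_apply,
      smul_eq_mul, hmin, ← Real.exp_add, normDist]
    congr 1
    rw [div_eq_mul_inv]
    ring
  obtain ⟨N, y, hy⟩ := hpsd.exists_vectors
  simp only [Matrix.of_apply] at hy
  have hself : ∀ u, ∑ i, y u i ^ 2 = 1 := fun u => by
    have h := hy u u
    have h0 : normDist x u u = 0 := by
      rw [normDist, max_self, real_inner_self_eq_norm_sq, div_self (hpos u).ne', sub_self]
    rw [h0, mul_zero, Real.exp_zero] at h
    simpa only [sq] using h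
  have hdist : ∀ u v, sqDist y u v = 2 * (1 - Real.exp (-c * normDist x u v)) := fun u v => by
    rw [← hy u v]
    have : ∀ i, (y u i - y v i) ^ 2 = y u i ^ 2 + y v i ^ 2 - 2 * (y u i * y v i) :=
      fun i => by ring
    simp only [sqDist, this, Finset.sum_sub_distrib, Finset.sum_add_distrib, hself,
      ← Finset.mul_sum]
    ring
  refine ⟨N, y, fun u => (hself u).le, fun u v w => ?_, fun u v h => ?_, fun u v => ?_⟩
  · rw [hdist, hdist, hdist]
    have h1 : Real.exp (-c * normDist x u v) * Real.exp (-c * normDist x v w) ≤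
        Real.exp (-c * normDist x u w) := by
      rw [← Real.exp_add, Real.exp_le_exp]
      nlinarith [normDist_triangle hx hne u v w]
    have h2 : ∀ u v, Real.exp (-c * normDist x u v) ≤ 1 := fun u v =>
      Real.exp_le_one_iff.2 (by nlinarith [normDist_nonneg hx u v])
    nlinarith [h2 u v, h2 v w]
  · rw [hdist]
    have h1 : 1 ≤ c * normDist x u v := by
      have := mul_le_mul_of_nonneg_left (le_normDist_of_far hne hβ0 hβ1 h) hc0.le
      have e : c * (β / 4) = 1 := by rw [hc]; field_simp
      linarith
    have h2 : Real.exp (-c * normDist x u v) ≤ Real.exp (-1) := Real.exp_le_exp.2 (by linarith)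
    have h3 : Real.exp (-1) ≤ 1 / 2 := by
      rw [Real.exp_neg, inv_eq_one_div]
      exact one_div_le_one_div_of_le (by norm_num) (by linarith [Real.add_one_le_exp 1])
    linarith
  · rw [hdist]
    have h1 := Real.add_one_le_exp (-c * normDist x u v)
    have h2 := mul_le_mul_of_nonneg_left (normSq_mul_normDist_le hx hne u v) hc0.le
    have e : 8 / β = 2 * c := by rw [hc]; ring
    rw [e]
    nlinarith [hpos u]

/-! ### Orthogonal separators -/

/-- The random partition of a vector family; parts separate far pairs and rarely cut a set of small
diameter compared to its norms. -/
theorem exists_vector_partition {V : Type} {H : Type*} [Fintype V] [NormedAddCommGroup H]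
    [InnerProductSpace ℝ H] {x : V → H} (hx : L22 x) {β : ℝ} (hβ0 : 0 < β) (hβ1 : β < 1)
    {L : ℝ} (hL1 : 1 ≤ L) (hL : Real.log (Fintype.card V) ≤ L) (l : ℕ) :
    ∃ (Ω : Type) (_ : Fintype Ω) (w : Ω → ℝ) (g : Ω → V → ℕ), IsProbDist w ∧
      (∀ u v, x u ≠ 0 → x v ≠ 0 → β * min (‖x u‖ ^ 2) (‖x v‖ ^ 2) ≤ ‖x u - x v‖ ^ 2 →
        Pr w (fun ω => g ω u = g ω v) ≤ (1 - 1 / 1620) ^ l) ∧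
      ∀ (e : Finset V) (t D : ℝ), 0 ≤ t → 0 ≤ D → (∀ u ∈ e, t ≤ ‖x u‖ ^ 2) →
        (∀ u ∈ e, ∀ v ∈ e, ‖x u - x v‖ ^ 2 ≤ D) →
        t * Pr w (fun ω => ∃ u ∈ e, ∃ v ∈ e, g ω u ≠ g ω v) ≤
          l * (1 / sepRadius L) * (8 / β * D) := by
  have hδ : 0 < sepRadius L := by
    have : 0 < √L := Real.sqrt_pos.2 (by linarith)
    unfold sepRadius; positivity
  let W := {u : V // x u ≠ 0}
  have hxW : L22 fun u : W => x u := ⟨fun u v w => hx.1 u v w, fun u v => hx.2 u v⟩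
  obtain ⟨N, y, hy, htri, hfar, hnear⟩ := exists_kernel_embedding hxW (fun u => u.2) hβ0 hβ1
  have hLW : Real.log (Fintype.card W) ≤ L := by
    refine le_trans ?_ hL
    rcases Nat.eq_zero_or_pos (Fintype.card W) with h | h
    · rw [h]
      simpa using Real.log_natCast_nonneg _
    · exact Real.log_le_log (by exact_mod_cast h) (by exact_mod_cast Fintype.card_subtype_le _)
  obtain ⟨Ω, _, w, g, hw, hg, hK⟩ :=
    (hasPartition_sqDist y hy htri hL1 hLW).pow (by norm_num) l
  refine ⟨Ω, inferInstance, w, fun ω u => if h : x u ≠ 0 then g ω ⟨u, h⟩ else 0, hw,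
    fun u v hu hv h => ?_, fun e t D ht hD hte hDe => ?_⟩
  · simpa only [hu, hv, ne_eq, not_false_eq_true, dite_true] using
      hg ⟨u, hu⟩ ⟨v, hv⟩ (hfar ⟨u, hu⟩ ⟨v, hv⟩ h)
  · rcases ht.eq_or_lt with rfl | ht
    · rw [zero_mul]
      positivity
    have hne : ∀ u ∈ e, x u ≠ 0 := fun u hu h0 => by
      have := hte u hu
      rw [h0] at this
      simp at this
      linarith
    have h := hK (e.subtype fun u => x u ≠ 0) (8 / β * D / t) (by positivity) fun u hu v hv => by
      rw [Finset.mem_subtype] at hu hv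
      rw [le_div_iff₀ ht, mul_comm]
      calc t * sqDist y u v ≤ ‖x u‖ ^ 2 * sqDist y u v :=
            mul_le_mul_of_nonneg_right (hte u hu) (sqDist_nonneg y u v)
        _ ≤ 8 / β * ‖x u - x v‖ ^ 2 := hnear u v
        _ ≤ 8 / β * D := mul_le_mul_of_nonneg_left (hDe u hu v hv) (by positivity)
    have h2 : Pr w (fun ω => ∃ u ∈ e, ∃ v ∈ e, (if h : x u ≠ 0 then g ω ⟨u, h⟩ else 0) ≠
        if h : x v ≠ 0 then g ω ⟨v, h⟩ else 0) ≤ l * (1 / sepRadius L) * (8 / β * D / t) := by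
      refine (Pr_mono hw ?_).trans h
      rintro ω ⟨u, hu, v, hv, huv⟩
      rw [dif_pos (hne u hu), dif_pos (hne v hv)] at huv
      exact ⟨⟨u, hne u hu⟩, Finset.mem_subtype.2 hu, ⟨v, hne v hv⟩, Finset.mem_subtype.2 hv, huv⟩
    calc _ ≤ t * (l * (1 / sepRadius L) * (8 / β * D / t)) := mul_le_mul_of_nonneg_left h2 ht.le
      _ = _ := by field_simp

theorem L22.normSq_sub_le {V H : Type*} [NormedAddCommGroup H] [InnerProductSpace ℝ H]
    {x : V → H} (hx : L22 x) (u v : V) : ‖x u‖ ^ 2 - ‖x v‖ ^ 2 ≤ ‖x u - x v‖ ^ 2 := by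
  rw [norm_sub_sq_real]
  linarith [hx.inner_le_right u v]

theorem normSq_sub_le_maxDistSq {V H : Type*} [NormedAddCommGroup H] (x : V → H) (e : Finset V)
    {u v : V} (hu : u ∈ e) (hv : v ∈ e) : ‖x u - x v‖ ^ 2 ≤ maxDistSq x e := by
  refine le_csSup ?_ ⟨u, hu, v, hv, rfl⟩
  refine (((e ×ˢ e).image fun p => ‖x p.1 - x p.2‖ ^ 2).finite_toSet.subset ?_).bddAbove
  rintro d ⟨a, ha, b, hb, rfl⟩
  simp only [Finset.coe_image, Set.mem_image, Finset.mem_coe, Finset.mem_product]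
  exact ⟨(a, b), ⟨ha, hb⟩, rfl⟩

/-- Rounding a random partition: keep the points above a random norm threshold whose part receives
a random label. -/
theorem exists_hOrthSep_of_partition {V : Type} {H : Type*} [Fintype V] [DecidableEq V] [Nonempty V]
    [NormedAddCommGroup H] [InnerProductSpace ℝ H] {x : V → H} (hx1 : ∀ u, ‖x u‖ ≤ 1) (hx : L22 x)
    {m β R : ℝ} (hm : 1 ≤ m) (hR : 0 ≤ R) {Ω : Type} [Fintype Ω] {w : Ω → ℝ} {g : Ω → V → ℕ}
    (hw : IsProbDist w)
    (hg : ∀ u v, x u ≠ 0 → x v ≠ 0 → β * min (‖x u‖ ^ 2) (‖x v‖ ^ 2) ≤ ‖x u - x v‖ ^ 2 →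
      Pr w (fun ω => g ω u = g ω v) ≤ 1 / (2 * m))
    (hcut : ∀ (e : Finset V) (t D : ℝ), 0 ≤ t → 0 ≤ D → (∀ u ∈ e, t ≤ ‖x u‖ ^ 2) →
      (∀ u ∈ e, ∀ v ∈ e, ‖x u - x v‖ ^ 2 ≤ D) →
      t * Pr w (fun ω => ∃ u ∈ e, ∃ v ∈ e, g ω u ≠ g ω v) ≤ R * D) :
    ∃ (μ : Finset V → ℝ) (α : ℝ), IsProbDist μ ∧ 1 / (Fintype.card V : ℝ) ≤ α ∧ 0 < α ∧
      IsHOrthSep x m β α (2 * m * (1 + R)) μ := by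
  obtain ⟨w₀, hw₀, hw₀1, hw₀2, hw₀c⟩ := exists_threshold_dist (fun u => ‖x u‖ ^ 2)
    (fun u => sq_nonneg _) fun u => pow_le_one₀ (norm_nonneg _) (hx1 u)
  obtain ⟨α, wT, hαn, hαm, hwT, hwT1, hwT2⟩ := exists_label_dist V (m := 2 * m) (by linarith)
  have hm0 : 0 < m := by linarith
  have hα0 : 0 < α := lt_of_lt_of_le (by positivity) hαm
  let π : Ω → V → V := fun ω u => Function.invFun (g ω) (g ω u)
  have hπ : ∀ ω u, g ω (π ω u) = g ω u := fun ω u => Function.invFun_eq ⟨u, rfl⟩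
  let S : Finset V × (Ω × Finset V) → Finset V := fun q =>
    Finset.univ.filter fun u => u ∈ q.1 ∧ π q.2.1 u ∈ q.2.2
  have hS : ∀ q u, u ∈ S q ↔ u ∈ q.1 ∧ π q.2.1 u ∈ q.2.2 := fun q u => by simp [S]
  let ν : Ω × Finset V → ℝ := condDist w fun _ => wT
  have hν : IsProbDist ν := hw.condDist fun _ => hwT
  let P : Finset V × (Ω × Finset V) → ℝ := condDist w₀ fun _ => ν
  have hP : IsProbDist P := hw₀.condDist fun _ => hν
  refine ⟨lawOf P S, α, hP.lawOf S, hαn, hα0, fun u => ?_, fun u v huv => ?_, fun e => ?_⟩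
  · rw [Pr_lawOf]
    simp only [hS]
    rw [Pr_prod w₀ ν (fun T => u ∈ T) fun p => π p.1 u ∈ p.2, hw₀1, Pr_condDist]
    simp only [hwT1, ← Finset.sum_mul, hw.2]
    ring
  · rw [Pr_lawOf]
    have e : (fun q => u ∈ S q ∧ v ∈ S q) = fun q => (u ∈ q.1 ∧ v ∈ q.1) ∧
        (π q.2.1 u ∈ q.2.2 ∧ π q.2.1 v ∈ q.2.2) := by
      funext q
      simp only [hS]
      exact propext and_and_and_comm
    rw [e, Pr_prod w₀ ν (fun T => u ∈ T ∧ v ∈ T) fun p => π p.1 u ∈ p.2 ∧ π p.1 v ∈ p.2, hw₀2]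
    have hzero : ∀ u, x u = 0 → ‖x u‖ ^ 2 = 0 := fun u h => by rw [h]; simp
    by_cases hu : x u = 0
    · rw [hzero u hu, min_eq_left (sq_nonneg _)]
      simp
    by_cases hv : x v = 0
    · rw [hzero v hv, min_eq_right (sq_nonneg _)]
      simp
    have hj : ∀ ω, Pr wT (fun T => π ω u ∈ T ∧ π ω v ∈ T) ≤
        α * (if g ω u = g ω v then 1 else 0) + α / (2 * m) := fun ω => by
      by_cases h : g ω u = g ω v
      · have : Pr wT (fun T => π ω u ∈ T ∧ π ω v ∈ T) ≤ α :=
          (Pr_mono hwT fun T h => h.1).trans_eq (hwT1 _)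
        have h0 : 0 ≤ α / (2 * m) := by positivity
        rw [if_pos h]
        linarith
      · rw [if_neg h, mul_zero, zero_add]
        exact hwT2 _ _ fun h' => h (by rw [← hπ ω u, ← hπ ω v, h'])
    have h2 : Pr ν (fun p => π p.1 u ∈ p.2 ∧ π p.1 v ∈ p.2) ≤ α / m := by
      rw [Pr_condDist]
      calc _ ≤ ∑ ω, w ω * (α * (if g ω u = g ω v then 1 else 0) + α / (2 * m)) :=
            Finset.sum_le_sum fun ω _ => mul_le_mul_of_nonneg_left (hj ω) (hw.1 ω)
        _ = α * Pr w (fun ω => g ω u = g ω v) + α / (2 * m) := by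
            simp only [mul_add, Finset.sum_add_distrib, ← Finset.sum_mul, hw.2, one_mul, Pr,
              Finset.mul_sum]
            congr 1
            refine Finset.sum_congr rfl fun ω _ => ?_
            split_ifs <;> ring
        _ ≤ α * (1 / (2 * m)) + α / (2 * m) :=
            add_le_add (mul_le_mul_of_nonneg_left (hg u v hu hv huv) hα0.le) le_rfl
        _ = α / m := by field_simp; norm_num
    calc _ ≤ min (‖x u‖ ^ 2) (‖x v‖ ^ 2) * (α / m) :=
          mul_le_mul_of_nonneg_left h2 (le_min (sq_nonneg _) (sq_nonneg _))
      _ = _ := by ring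
  · rw [Pr_lawOf]
    rcases e.eq_empty_or_nonempty with rfl | hne
    · rw [Pr_eq_zero _ fun q h => by simpa [Cuts] using h.1]
      simp [maxDistSq]
    obtain ⟨z, hz, hmin⟩ := e.exists_min_image (fun u => ‖x u‖ ^ 2) hne
    obtain ⟨b, hb, hmax⟩ := e.exists_max_image (fun u => ‖x u‖ ^ 2) hne
    set D := maxDistSq x e
    have hDe : ∀ u ∈ e, ∀ v ∈ e, ‖x u - x v‖ ^ 2 ≤ D := fun u hu v hv =>
      normSq_sub_le_maxDistSq x e hu hv
    have hD0 : 0 ≤ D := (sq_nonneg _).trans (hDe z hz z hz)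
    have h1 := hw₀c e (‖x z‖ ^ 2) (‖x b‖ ^ 2) (sq_nonneg _) (hmin b hb)
      (pow_le_one₀ (norm_nonneg _) (hx1 b)) fun u hu => ⟨hmin u hu, hmax u hu⟩
    have h2 := hcut e (‖x z‖ ^ 2) D (sq_nonneg _) hD0 hmin hDe
    have h3 : Pr P (fun q => Cuts (S q) e) ≤
        Pr P (fun q => ∃ u ∈ e, ∃ v ∈ e, u ∈ q.1 ∧ v ∉ q.1) +
        Pr P (fun q => z ∈ q.1 ∧ ∃ u ∈ e, ∃ v ∈ e, g q.2.1 u ≠ g q.2.1 v) := by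
      refine (Pr_mono hP ?_).trans (Pr_or_le hP _ _)
      rintro q ⟨⟨u, hu⟩, ⟨v, hv⟩⟩
      rw [Finset.mem_inter, hS] at hu
      rw [Finset.mem_sdiff, hS] at hv
      by_contra! hcon
      have hin : ∀ a ∈ e, a ∈ q.1 := fun a ha => hcon.1 u hu.1 a ha hu.2.1
      have hcol := hcon.2 (hin z hz) u hu.1 v hv.1
      refine hv.2 ⟨hin v hv.1, ?_⟩
      have : π q.2.1 v = π q.2.1 u := by simp only [π, hcol]
      rw [this]
      exact hu.2.2
    rw [Pr_prod_fst w₀ hν fun T => ∃ u ∈ e, ∃ v ∈ e, u ∈ T ∧ v ∉ T,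
      Pr_prod w₀ ν (fun T => z ∈ T) fun p => ∃ u ∈ e, ∃ v ∈ e, g p.1 u ≠ g p.1 v, hw₀1,
      Pr_prod_fst w hwT fun ω => ∃ u ∈ e, ∃ v ∈ e, g ω u ≠ g ω v] at h3
    have h4 := (hx.normSq_sub_le b z).trans (hDe b hb z hz)
    have h5 : 1 ≤ α * (2 * m) := by rwa [div_le_iff₀ (by positivity)] at hαm
    have h6 : 1 * ((1 + R) * D) ≤ α * (2 * m) * ((1 + R) * D) :=
      mul_le_mul_of_nonneg_right h5 (by positivity)
    linarith

theorem one_sub_pow_ceil_le {m : ℝ} (hm : 0 < m) :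
    ((1 : ℝ) - 1 / 1620) ^ ⌈1620 * Real.log m⌉₊ ≤ 1 / m := by
  set l := ⌈1620 * Real.log m⌉₊ with hl
  have h1 : (1 : ℝ) - 1 / 1620 ≤ Real.exp (-(1 / 1620)) := by
    linarith [Real.add_one_le_exp (-(1 / 1620 : ℝ))]
  calc ((1 : ℝ) - 1 / 1620) ^ l ≤ Real.exp (-(1 / 1620)) ^ l := pow_le_pow_left₀ (by norm_num) h1 l
    _ = Real.exp (l * (-(1 / 1620))) := (Real.exp_nat_mul _ _).symm
    _ ≤ Real.exp (-Real.log m) := Real.exp_le_exp.2 (by linarith [Nat.le_ceil (1620 * Real.log m)])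
    _ = 1 / m := by rw [Real.exp_neg, Real.exp_log hm, one_div]

theorem log_le_logb_two {a : ℝ} (ha : 1 ≤ a) : Real.log a ≤ Real.logb 2 a := by
  rw [Real.logb, le_div_iff₀ (Real.log_pos (by norm_num))]
  exact mul_le_of_le_one_right (Real.log_nonneg ha) (by linarith [Real.log_two_lt_d9])

theorem stmt_1 : ∃ C : ℝ, 0 < C ∧
    ∀ (V : Type) [Fintype V] [DecidableEq V]
      (H : Type) [NormedAddCommGroup H] [InnerProductSpace ℝ H]
      (x : V → H) (m β : ℝ),
      2 ≤ Fintype.card V → (∀ u, ‖x u‖ ≤ 1) → L22 x →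
      4 ≤ m → 0 < β → β < 1 →
      ∃ (μ : Finset V → ℝ) (α D : ℝ), IsProbDist μ ∧
        1 / (Fintype.card V : ℝ) ≤ α ∧ 0 < α ∧ 1 ≤ D ∧
        D ≤ C * β⁻¹ * m * Real.logb 2 m * Real.logb 2 (Real.logb 2 m) *
              Real.sqrt (Real.logb 2 (Fintype.card V)) ∧
        IsHOrthSep x m β α D μ := by
  refine ⟨2 * (1 + 2431 * 8 * 4 * 51840 ^ 2), by norm_num, ?_⟩
  intro V _ _ H _ _ x m β hn hx1 hx hm hβ0 hβ1
  have : Nonempty V := Fintype.card_pos_iff.1 (by omega)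
  have hnR : (2 : ℝ) ≤ Fintype.card V := by exact_mod_cast hn
  set L := Real.logb 2 (Fintype.card V) with hLdef
  have hL1 : 1 ≤ L := by
    rw [hLdef, Real.le_logb_iff_rpow_le (by norm_num) (by linarith), Real.rpow_one]
    exact hnR
  set lam := Real.logb 2 m with hlam
  have hlam2 : 2 ≤ lam := by
    rw [hlam, Real.le_logb_iff_rpow_le (by norm_num) (by linarith)]
    norm_num
    exact hm
  have hll : 1 ≤ Real.logb 2 lam := by
    rw [Real.le_logb_iff_rpow_le (by norm_num) (by linarith), Real.rpow_one]
    exact hlam2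
  set l := ⌈1620 * Real.log (2 * m)⌉₊ with hl
  have hlle : (l : ℝ) ≤ 2431 * lam := by
    have h1 : Real.log (2 * m) ≤ 1 + lam := by
      refine (log_le_logb_two (by linarith)).trans_eq ?_
      rw [Real.logb_mul (by norm_num) (by linarith), Real.logb_self_eq_one (by norm_num)]
    have h0 : 0 ≤ Real.log (2 * m) := Real.log_nonneg (by linarith)
    have := Nat.ceil_lt_add_one (a := 1620 * Real.log (2 * m)) (by linarith)
    linarith
  obtain ⟨Ω, _, w, g, hw, hg, hcut⟩ := exists_vector_partition hx hβ0 hβ1 hL1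
    (log_le_logb_two (by linarith)) l
  have hq : ((1 : ℝ) - 1 / 1620) ^ l ≤ 1 / (2 * m) := one_sub_pow_ceil_le (by linarith)
  have hs1 : 1 ≤ √L := Real.one_le_sqrt.2 hL1
  have hK : 1 / sepRadius L = 4 * 51840 ^ 2 * √L := by
    have : √L ≠ 0 := by linarith
    unfold sepRadius
    field_simp
  set R := l * (1 / sepRadius L) * (8 / β) with hRdef
  have hR0 : 0 ≤ R := by rw [hRdef, hK]; positivity
  obtain ⟨μ, α, hμ, hα1, hα0, hsep⟩ := exists_hOrthSep_of_partition hx1 hx (m := m) (by linarith) hR0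
    hw (fun u v hu hv h => (hg u v hu hv h).trans hq) fun e t D ht hD h1 h2 =>
      (hcut e t D ht hD h1 h2).trans_eq (by rw [hRdef]; ring)
  refine ⟨μ, α, 2 * m * (1 + R), hμ, hα1, hα0, by nlinarith, ?_, hsep⟩
  have hb1 : 1 ≤ β⁻¹ := (one_le_inv₀ hβ0).2 hβ1.le
  have hB : 1 ≤ β⁻¹ * lam * √L := by
    have h1 : 1 ≤ β⁻¹ * lam := one_le_mul_of_one_le_of_one_le hb1 (by linarith)
    exact one_le_mul_of_one_le_of_one_le h1 hs1
  have hR : R ≤ 2431 * 8 * 4 * 51840 ^ 2 * (β⁻¹ * lam * √L) := by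
    rw [hRdef, hK]
    calc l * (4 * 51840 ^ 2 * √L) * (8 / β)
        ≤ 2431 * lam * (4 * 51840 ^ 2 * √L) * (8 / β) := by gcongr
      _ = _ := by rw [div_eq_mul_inv]; ring
  calc 2 * m * (1 + R) ≤ 2 * m * ((1 + 2431 * 8 * 4 * 51840 ^ 2) * (β⁻¹ * lam * √L)) :=
        mul_le_mul_of_nonneg_left (by linarith) (by linarith)
    _ = 2 * (1 + 2431 * 8 * 4 * 51840 ^ 2) * β⁻¹ * m * lam * √L * 1 := by ring
    _ ≤ 2 * (1 + 2431 * 8 * 4 * 51840 ^ 2) * β⁻¹ * m * lam * √L * Real.logb 2 lam :=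
        mul_le_mul_of_nonneg_left hll (by positivity)
    _ = _ := by ring

end
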